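/- arXiv:2409.20341 — 7 statements merged into one kernel-verified Lean document; each statement's English description precedes it below -/
import Mathlib

section
/- For every word x over the positive integers, the word C(x) contains no four consecutive equal symbols; that is, C(x) has no contiguous subword of the form a,a,a,a. -/
/-- The look-and-say (audioactive) derivation: replace each maximal run of
`k` consecutive equal symbols `a` in the word by the two symbols `k, a`. -/
def lookAndSay (x : List ℕ+) : List ℕ+ :=
  (x.splitBy (· == ·)).flatMap fun r => [r.length.toPNat', r.headD 1]

theorem one_day_aux (f g : List ℕ+ → ℕ+) (a : ℕ+) (L : List (List ℕ+))
    (h : L.IsChain (fun r s => g r ≠ g s)) :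
    ¬ [a, a, a, a] <:+: L.flatMap fun r => [f r, g r] := by
  induction L with
  | nil => simp
  | cons r L ih =>
    have ih' := ih h.tail
    intro hc
    simp only [List.flatMap_cons, List.cons_append, List.nil_append, List.infix_cons_iff] at hc
    rcases hc with hc | hc | hc
    · cases L with
      | nil => simp at hc
      | cons s L =>
        simp only [List.isChain_cons_cons] at h
        simp only [List.flatMap_cons, List.cons_append, List.nil_append,
          List.cons_prefix_cons] at hc
        exact h.1 (hc.2.1.symm.trans hc.2.2.2.1)
    · cases L with
      | nil => simp at hc
      | cons s L =>
        simp only [List.isChain_cons_cons] at h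
        simp only [List.flatMap_cons, List.cons_append, List.nil_append,
          List.cons_prefix_cons] at hc
        exact h.1 (hc.1.symm.trans hc.2.2.1)
    · exact ih' hc

theorem one_day_run (r : List ℕ+) (h : r.IsChain (fun x y => (x == y) = true)) (hr : r ≠ []) :
    r.getLast hr = r.headD 1 := by
  induction r with
  | nil => exact absurd rfl hr
  | cons b r ih =>
    cases r with
    | nil => rfl
    | cons c r =>
      simp only [List.isChain_cons_cons] at h
      have := ih h.2 (by simp)
      have hb : b = c := by simpa using h.1
      simpa [hb] using this

/-- One-Day Theorem: for every word over the positive integers, its look-and-say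
derivation contains no contiguous subword of the form `a, a, a, a`. -/
theorem one_day (x : List ℕ+) (a : ℕ+) : ¬ [a, a, a, a] <:+: lookAndSay x := by
  unfold lookAndSay
  apply one_day_aux (fun r => r.length.toPNat') (fun r => r.headD 1)
  have h1 := List.isChain_getLast_head_splitBy (· == ·) x
  have h2 : ∀ r ∈ x.splitBy (· == ·), r.IsChain (fun x y => (x == y) = true) :=
    fun r hr => List.isChain_of_mem_splitBy hr
  refine List.IsChain.imp_of_mem_imp ?_ h1
  rintro r s hr hs ⟨ha, hb, hab⟩
  have := one_day_run r (h2 r hr) ha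
  rw [this] at hab
  cases s with
  | nil => exact absurd rfl hb
  | cons c s => simpa using hab
end

section
/- If x is a word over the positive integers containing no four consecutive equal symbols, then C(x) contains no contiguous subword (a, a) with a ≥ 4; that is, two adjacent equal symbols of C(x) are always at most 3. -/
/-- A run of length at most three is announced by a count smaller than four. -/
theorem toPNat_ne_of_le {n : ℕ} {a : ℕ+} (hn : n ≤ 3) (ha : 4 ≤ a) : n.toPNat' ≠ a := by
  intro h
  have h1 : (4 : ℕ) ≤ (a : ℕ) := ha
  have h2 : ((n.toPNat' : ℕ+) : ℕ) = (a : ℕ) := by rw [h]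
  rw [Nat.toPNat'_coe] at h2
  split_ifs at h2 <;> omega

theorem flatMap_no_pair {a : ℕ+} (ha : 4 ≤ a) (L : List (List ℕ+))
    (hL : ∀ r ∈ L, r.length ≤ 3) :
    ¬ [a, a] <:+: L.flatMap fun r => [r.length.toPNat', r.headD 1] := by
  induction L with
  | nil => simp
  | cons r L ih =>
    have hr := toPNat_ne_of_le (hL r (by simp)) ha
    have ih' := ih fun s hs => hL s (by simp [hs])
    rw [List.flatMap_cons]
    simp only [List.cons_append, List.nil_append]
    rw [List.infix_cons_iff, List.infix_cons_iff]
    rintro (h | h | h)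
    · rw [List.cons_prefix_cons] at h
      exact hr h.1.symm
    · rw [List.cons_prefix_cons] at h
      cases L with
      | nil => simp at h
      | cons s L =>
        rw [List.flatMap_cons] at h
        simp only [List.cons_append, List.cons_prefix_cons] at h
        exact toPNat_ne_of_le (hL s (by simp)) ha h.2.1.symm
    · exact ih' h

/-- If `x` contains no four consecutive equal symbols, then `C(x)` contains no
contiguous subword `(a, a)` with `a ≥ 4`. -/
theorem no_big_adjacent_pair (x : List ℕ+)
    (hx : ∀ a : ℕ+, ¬ [a, a, a, a] <:+: x) :
    ∀ a : ℕ+, 4 ≤ a → ¬ [a, a] <:+: lookAndSay x := by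
  intro a ha
  refine flatMap_no_pair ha _ fun r hr => ?_
  by_contra! hlen
  have hc := List.isChain_of_mem_splitBy hr
  have hinf : r <:+: x := by
    obtain ⟨s, t, hst⟩ := List.append_of_mem hr
    have h := List.flatten_splitBy (· == ·) x
    rw [hst] at h
    exact ⟨s.flatten, t.flatten, by simpa using h⟩
  match r, hlen, hc, hinf with
  | b :: c :: d :: e :: t, _, hc, hinf =>
    simp only [List.isChain_cons_cons, beq_iff_eq] at hc
    obtain ⟨rfl, rfl, rfl, _⟩ := hc
    exact hx b (List.IsInfix.trans ⟨[], t, rfl⟩ hinf)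
end

section
/- For all nonempty words u and v over the positive integers, one has C^n(u ++ v) = C^n(u) ++ C^n(v) for all n ≥ 0 if and only if, for all n ≥ 0, the last symbol of C^n(u) differs from the first symbol of C^n(v). -/
/-- Number of changes of symbol in the word `a :: l`. -/
def changes : ℕ+ → List ℕ+ → ℕ
  | _, [] => 0
  | a, b :: l => (if a = b then 0 else 1) + changes b l

theorem length_splitBy_loop (l : List ℕ+) (a : ℕ+) (g : List ℕ+) (gs : List (List ℕ+)) :
    (List.splitBy.loop (· == ·) l a g gs).length = gs.length + 1 + changes a l := by
  induction l generalizing a g gs with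
  | nil => simp [List.splitBy.loop, changes]
  | cons b l ih =>
    rw [List.splitBy.loop, changes]
    by_cases h : a = b
    · simp [h, ih]
    · have h2 : (a == b) = false := by simp [h]
      simp only [h2, ih, h, if_false, List.length_cons]
      omega

theorem length_lookAndSay_cons (a : ℕ+) (l : List ℕ+) :
    (lookAndSay (a :: l)).length = 2 * (1 + changes a l) := by
  have h := length_splitBy_loop l a [] []
  simp only [lookAndSay, List.splitBy, List.length_flatMap, List.length_cons, List.length_nil,
    List.map_const', List.sum_replicate, h, smul_eq_mul]
  omega

theorem changes_append (a : ℕ+) (l : List ℕ+) (b : ℕ+) (m : List ℕ+)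
    (h : (a :: l).getLast? = some b) :
    changes a (l ++ b :: m) = changes a l + changes b m := by
  induction l generalizing a with
  | nil => simp_all [changes]
  | cons c l ih =>
    rw [List.getLast?_cons_cons] at h
    simp only [List.cons_append, changes, ih c h]
    omega

theorem lookAndSay_append (x y : List ℕ+) (h : x.getLast? ≠ y.head?) :
    lookAndSay (x ++ y) = lookAndSay x ++ lookAndSay y := by
  unfold lookAndSay
  rw [List.splitBy_append, List.flatMap_append]
  intro a ha b hb
  rw [beq_eq_false_iff_ne]
  rintro rfl
  exact h (ha.trans hb.symm)

theorem lookAndSay_append_ne (x y : List ℕ+) (hx : x ≠ []) (h : x.getLast? = y.head?) :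
    lookAndSay (x ++ y) ≠ lookAndSay x ++ lookAndSay y := by
  intro he
  cases x with
  | nil => exact hx rfl
  | cons a l =>
    cases y with
    | nil => simp at h
    | cons b m =>
      have h2 := congrArg List.length he
      rw [List.head?_cons] at h
      rw [List.length_append, List.cons_append, length_lookAndSay_cons, length_lookAndSay_cons,
        length_lookAndSay_cons, changes_append a l b m h] at h2
      omega

theorem iterate_lookAndSay_ne_nil (x : List ℕ+) (hx : x ≠ []) (n : ℕ) :
    lookAndSay^[n] x ≠ [] := by
  induction n with
  | zero => exact hx
  | succ n ih =>
    rw [Function.iterate_succ_apply']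
    obtain ⟨a, l, h⟩ := List.exists_cons_of_ne_nil ih
    rw [h]
    intro h0
    have := length_lookAndSay_cons a l
    rw [h0, List.length_nil] at this
    omega

/-- For nonempty words `u` and `v`, `C^n(u ++ v) = C^n(u) ++ C^n(v)` holds for
all `n ≥ 0` iff, for all `n ≥ 0`, the last symbol of `C^n(u)` differs from the
first symbol of `C^n(v)`. -/
theorem splits_iff_last_ne_head (u v : List ℕ+) (hu : u ≠ []) (hv : v ≠ []) :
    (∀ n : ℕ, lookAndSay^[n] (u ++ v) = lookAndSay^[n] u ++ lookAndSay^[n] v) ↔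
      (∀ n : ℕ, (lookAndSay^[n] u).getLast? ≠ (lookAndSay^[n] v).head?) := by
  constructor
  · intro H n h
    apply lookAndSay_append_ne _ _ (iterate_lookAndSay_ne_nil u hu n) h
    rw [← H n]
    simpa only [Function.iterate_succ_apply'] using H (n + 1)
  · intro H n
    induction n with
    | zero => rfl
    | succ n ih =>
      simp only [Function.iterate_succ_apply']
      rw [ih, lookAndSay_append _ _ (H n)]
end

section
/- Every nonempty word x over the positive integers admits a unique splitting into atoms: there exist atoms u_1, …, u_r with x = u_1 ++ ⋯ ++ u_r and C^n(x) = C^n(u_1) ++ ⋯ ++ C^n(u_r) for all n ≥ 0, and this sequence of atoms is unique. -/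
/-- `x` splits into the list of factors `us`. -/
def SplitsInto (x : List ℕ+) (us : List (List ℕ+)) : Prop :=
  x = us.flatten ∧ ∀ n : ℕ, lookAndSay^[n] x = (us.map fun u => lookAndSay^[n] u).flatten

/-- An atom: a nonempty word that does not split as the concatenation of two
nonempty words. -/
def IsAtomWord (x : List ℕ+) : Prop :=
  x ≠ [] ∧ ¬ ∃ u v : List ℕ+, u ≠ [] ∧ v ≠ [] ∧ x = u ++ v ∧
    ∀ n : ℕ, lookAndSay^[n] x = lookAndSay^[n] u ++ lookAndSay^[n] v


theorem ls_nil : lookAndSay [] = [] := rfl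

theorem ls_single (a : ℕ+) : lookAndSay [a] = [1, a] := rfl

theorem ls_cons_ne {a b : ℕ+} (x : List ℕ+) (h : a ≠ b) :
    lookAndSay (a :: b :: x) = 1 :: a :: lookAndSay (b :: x) := by
  have h1 : (a :: b :: x).splitBy (· == ·) = [a] :: (b :: x).splitBy (· == ·) := by
    have := List.splitBy_append (r := fun a b : ℕ+ => a == b) (l := [a]) (m := b :: x)
      (by simp [h])
    exact this
  unfold lookAndSay
  rw [h1]
  rfl

theorem ls_cons_eq (a : ℕ+) (x : List ℕ+) :
    ∃ k k' t, lookAndSay (a :: x) = k :: a :: t ∧ lookAndSay (a :: a :: x) = k' :: a :: t := by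
  obtain ⟨g, gs, h⟩ : ∃ g gs, (a :: x).splitBy (· == ·) = (a :: g) :: gs := by
    rcases h : (a :: x).splitBy (· == ·) with _ | ⟨g, gs⟩
    · simp at h
    · have h1 := List.flatten_splitBy (· == ·) (a :: x)
      have h2 := List.nil_notMem_splitBy (· == ·) (a :: x)
      rw [h] at h1 h2
      rcases g with _ | ⟨c, g⟩
      · simp at h2
      · simp at h1
        exact ⟨g, gs, by rw [h1.1]⟩
  have h' : (a :: a :: x).splitBy (· == ·) = (a :: a :: g) :: gs := by
    rw [List.splitBy_eq_iff] at h ⊢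
    obtain ⟨h1, h2, h3, h4⟩ := h
    refine ⟨by rw [h1]; simp, by simpa using h2, ?_, ?_⟩
    · intro m hm
      rcases List.mem_cons.1 hm with rfl | hm
      · have := h3 (a :: g) (by simp)
        simpa using this
      · exact h3 m (by simp [hm])
    · rw [List.isChain_cons] at h4 ⊢
      refine ⟨?_, h4.2⟩
      intro y hy
      obtain ⟨ha, hb, h5⟩ := h4.1 y hy
      exact ⟨by simp, hb, by simpa using h5⟩
  refine ⟨(a :: g).length.toPNat', (a :: a :: g).length.toPNat',
    gs.flatMap fun r => [r.length.toPNat', r.headD 1], ?_, ?_⟩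
  · unfold lookAndSay
    rw [h]
    rfl
  · unfold lookAndSay
    rw [h']
    rfl

theorem ls_getLast? (x : List ℕ+) : (lookAndSay x).getLast? = x.getLast? := by
  induction x with
  | nil => rfl
  | cons a x ih =>
    cases x with
    | nil => rfl
    | cons b x =>
      by_cases h : a = b
      · subst h
        obtain ⟨k, k', t, h1, h2⟩ := ls_cons_eq a x
        rw [h1] at ih
        rw [h2, List.getLast?_cons_cons (a := a), ← ih]
        simp
      · rw [ls_cons_ne x h, List.getLast?_cons_cons (a := a), ← ih]
        have : lookAndSay (b :: x) ≠ [] := by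
          intro h0
          rw [h0] at ih
          simpa using ih.symm
        obtain ⟨c, l, hl⟩ := List.exists_cons_of_ne_nil this
        rw [hl]
        simp

theorem ls_append {a b : List ℕ+} (h : a = [] ∨ b.head? ≠ a.getLast?) :
    lookAndSay (a ++ b) = lookAndSay a ++ lookAndSay b := by
  unfold lookAndSay
  rw [List.splitBy_append, List.flatMap_append]
  intro x hx y hy
  rcases h with rfl | h
  · simp at hx
  · simp at hx hy ⊢
    rintro rfl
    exact h (by rw [hx, hy])

theorem ls_append_len {a b : List ℕ+} (ha : a ≠ []) (h : b.head? = a.getLast?) :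
    (lookAndSay (a ++ b)).length < (lookAndSay a).length + (lookAndSay b).length := by
  induction a with
  | nil => simp at ha
  | cons c a ih =>
    cases a with
    | nil =>
      rcases b with _ | ⟨d, b⟩
      · simp at h
      · simp at h
        subst h
        obtain ⟨k, k', t, h1, h2⟩ := ls_cons_eq d b
        simp [h1, h2, ls_single]
    | cons d a =>
      have ih := ih (by simp) (by simpa using h)
      by_cases hcd : c = d
      · subst hcd
        obtain ⟨k, k', t, h1, h2⟩ := ls_cons_eq c a
        obtain ⟨l, l', s, h3, h4⟩ := ls_cons_eq c (a ++ b)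
        simp only [List.cons_append] at ih ⊢
        rw [h1, h3] at ih
        rw [h2, h4]
        simpa using ih
      · simp only [List.cons_append] at ih ⊢
        rw [ls_cons_ne _ hcd, ls_cons_ne _ hcd]
        simp only [List.length_cons]
        omega

theorem ls_append_iff {a b : List ℕ+} (ha : a ≠ []) :
    lookAndSay (a ++ b) = lookAndSay a ++ lookAndSay b ↔ b.head? ≠ a.getLast? := by
  refine ⟨fun h h' => ?_, fun h => ls_append (Or.inr h)⟩
  have := ls_append_len ha h'
  rw [h] at this
  simp at this

theorem ls_append_len_le (a b : List ℕ+) :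
    (lookAndSay (a ++ b)).length ≤ (lookAndSay a).length + (lookAndSay b).length := by
  by_cases h : a = [] ∨ b.head? ≠ a.getLast?
  · rw [ls_append h]; simp
  · push Not at h
    exact (ls_append_len h.1 h.2).le

theorem ls_append_of_len (a b : List ℕ+)
    (hl : (lookAndSay a).length + (lookAndSay b).length ≤ (lookAndSay (a ++ b)).length) :
    lookAndSay (a ++ b) = lookAndSay a ++ lookAndSay b := by
  by_cases h : a = [] ∨ b.head? ≠ a.getLast?
  · exact ls_append h
  · push Not at h
    have := ls_append_len h.1 h.2
    omega

theorem iter_getLast? (n : ℕ) (x : List ℕ+) : (lookAndSay^[n] x).getLast? = x.getLast? := by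
  induction n with
  | zero => rfl
  | succ n ih => rw [Function.iterate_succ_apply', ls_getLast?, ih]

theorem iter_eq_nil {n : ℕ} {x : List ℕ+} : lookAndSay^[n] x = [] ↔ x = [] := by
  rw [← List.getLast?_eq_none_iff, iter_getLast?, List.getLast?_eq_none_iff]

/-- `u` and `v` never interact. -/
def Sp (u v : List ℕ+) : Prop :=
  ∀ n : ℕ, lookAndSay^[n] (u ++ v) = lookAndSay^[n] u ++ lookAndSay^[n] v

theorem sp_iff {u v : List ℕ+} (hu : u ≠ []) :
    Sp u v ↔ ∀ n : ℕ, (lookAndSay^[n] v).head? ≠ u.getLast? := by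
  constructor
  · intro h n
    have h1 := h (n + 1)
    simp only [Function.iterate_succ_apply'] at h1
    rw [h n, ls_append_iff (by rwa [Ne, iter_eq_nil]), iter_getLast?] at h1
    exact h1
  · intro h n
    induction n with
    | zero => rfl
    | succ n ih =>
      simp only [Function.iterate_succ_apply']
      rw [ih, ls_append_iff (by rwa [Ne, iter_eq_nil]), iter_getLast?]
      exact h n

theorem flatten_len_le (ws : List (List ℕ+)) :
    (lookAndSay ws.flatten).length ≤ ((ws.map lookAndSay).flatten).length := by
  induction ws with
  | nil => simp [ls_nil]
  | cons w ws ih =>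
    have := ls_append_len_le w ws.flatten
    simp only [List.flatten_cons, List.map_cons, List.length_append]
    omega

theorem flatten_step {w : List ℕ+} {ws : List (List ℕ+)}
    (h : lookAndSay (w ++ ws.flatten) = lookAndSay w ++ (ws.map lookAndSay).flatten) :
    lookAndSay ws.flatten = (ws.map lookAndSay).flatten := by
  have h1 := flatten_len_le ws
  have h2 := congrArg List.length h
  rw [List.length_append] at h2
  rw [ls_append_of_len _ _ (by omega)] at h
  exact List.append_cancel_left h

theorem splitsInto_cons {u : List ℕ+} {us : List (List ℕ+)} {x : List ℕ+}
    (h : SplitsInto x (u :: us)) :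
    x = u ++ us.flatten ∧ Sp u us.flatten ∧ SplitsInto us.flatten us := by
  obtain ⟨rfl, h⟩ := h
  have key : ∀ n : ℕ, lookAndSay^[n] us.flatten = (us.map fun u => lookAndSay^[n] u).flatten := by
    intro n
    induction n with
    | zero => simp
    | succ n ih =>
      have h1 := h (n + 1)
      simp only [Function.iterate_succ_apply'] at h1 ⊢
      rw [h n] at h1
      have h2 := flatten_step (w := lookAndSay^[n] u) (ws := us.map fun u => lookAndSay^[n] u)
        (by simpa [Function.comp_def] using h1)
      rw [ih, h2]
      simp [Function.comp_def]
  refine ⟨by simp, ?_, rfl, key⟩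
  intro n
  rw [key n]
  simpa using h n

theorem no_short {u v F G : List ℕ+} (hu : u ≠ []) (hv : IsAtomWord v)
    (he : u ++ F = v ++ G) (h1 : Sp u F) (h2 : Sp v G) : v.length ≤ u.length := by
  by_contra hlt
  push Not at hlt
  obtain ⟨w, rfl⟩ : ∃ w, v = u ++ w := by
    rcases List.append_eq_append_iff.1 he with ⟨w, hw, -⟩ | ⟨w, hw, -⟩
    · exact ⟨w, hw⟩
    · rw [hw] at hlt
      simp at hlt
  have hw : w ≠ [] := by
    rintro rfl
    simp at hlt
  rw [List.append_assoc] at he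
  have hF := List.append_cancel_left he
  subst hF
  have hwG : Sp w G := by
    rw [sp_iff (by simp [hu])] at h2
    rw [sp_iff hw]
    intro n
    have := h2 n
    rwa [List.getLast?_append_of_ne_nil _ hw] at this
  refine hv.2 ⟨u, w, hu, hw, rfl, ?_⟩
  change Sp u w
  rw [sp_iff hu] at h1 ⊢
  intro n
  have := h1 n
  rwa [hwG n, List.head?_append_of_ne_nil _ (by rwa [Ne, iter_eq_nil])] at this

theorem split_unique (us : List (List ℕ+)) : ∀ (vs : List (List ℕ+)) (x : List ℕ+),
    (∀ u ∈ us, IsAtomWord u) → (∀ v ∈ vs, IsAtomWord v) →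
    SplitsInto x us → SplitsInto x vs → us = vs := by
  induction us with
  | nil =>
    intro vs x _ hv h1 h2
    cases vs with
    | nil => rfl
    | cons v vs =>
      have h3 := h1.1
      rw [h2.1] at h3
      have := (hv v (by simp)).1
      simp [this] at h3
  | cons u us ih =>
    intro vs x hu hv h1 h2
    have hu1 := hu u (by simp)
    cases vs with
    | nil =>
      have h3 := h1.1
      rw [h2.1] at h3
      simp [hu1.1] at h3
    | cons v vs =>
      have hv1 := hv v (by simp)
      obtain ⟨e1, s1, t1⟩ := splitsInto_cons h1
      obtain ⟨e2, s2, t2⟩ := splitsInto_cons h2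
      rw [e1] at e2
      have hl := le_antisymm (no_short hv1.1 hu1 e2.symm s2 s1) (no_short hu1.1 hv1 e2 s1 s2)
      obtain ⟨rfl, e3⟩ := List.append_inj e2 hl
      rw [← e3] at t2
      rw [ih vs _ (fun w hw => hu w (by simp [hw])) (fun w hw => hv w (by simp [hw])) t1 t2]

theorem split_exists (m : ℕ) : ∀ x : List ℕ+, x.length ≤ m → x ≠ [] →
    ∃ us : List (List ℕ+), (∀ u ∈ us, IsAtomWord u) ∧ SplitsInto x us := by
  induction m with
  | zero =>
    intro x h hx
    exact absurd (List.length_eq_zero_iff.1 (by omega)) hx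
  | succ m ih =>
    intro x h hx
    by_cases hat : IsAtomWord x
    · exact ⟨[x], by simpa using hat, by simp, by simp⟩
    · have : ∃ u v : List ℕ+, u ≠ [] ∧ v ≠ [] ∧ x = u ++ v ∧
          ∀ n : ℕ, lookAndSay^[n] x = lookAndSay^[n] u ++ lookAndSay^[n] v := by
        by_contra hc
        exact hat ⟨hx, hc⟩
      obtain ⟨u, v, hu, hv, rfl, hs⟩ := this
      have lu := List.length_pos_iff.2 hu
      have lv := List.length_pos_iff.2 hv
      rw [List.length_append] at h
      obtain ⟨us, a1, b1, c1⟩ := ih u (by omega) hu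
      obtain ⟨vs, a2, b2, c2⟩ := ih v (by omega) hv
      refine ⟨us ++ vs, ?_, ?_, ?_⟩
      · intro w hw
        rcases List.mem_append.1 hw with hw | hw
        · exact a1 w hw
        · exact a2 w hw
      · rw [List.flatten_append, ← b1, ← b2]
      · intro n
        rw [hs n, c1 n, c2 n, List.map_append, List.flatten_append]

/-- Every nonempty word admits a unique splitting into atoms. -/
theorem unique_splitting_into_atoms (x : List ℕ+) (hx : x ≠ []) :
    ∃! us : List (List ℕ+), (∀ u ∈ us, IsAtomWord u) ∧ SplitsInto x us := by
  obtain ⟨us, h1, h2⟩ := split_exists x.length x le_rfl hx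
  exact ⟨us, ⟨h1, h2⟩, fun vs hvs => split_unique vs us x hvs.1 h1 hvs.2 h2⟩
end

section
/- The word (3,2,2,1,2) splits as (3)·(2,2,1,2); that is, C^n((3,2,2,1,2)) = C^n((3)) ++ C^n((2,2,1,2)) for all n ≥ 0. -/
/-- The derivation is additive at a boundary between distinct symbols. -/
theorem lookAndSay_append_s11 (u v : List ℕ+) (a b : ℕ+) (h : a ≠ b) :
    lookAndSay ((u ++ [a]) ++ (b :: v)) = lookAndSay (u ++ [a]) ++ lookAndSay (b :: v) := by
  unfold lookAndSay
  rw [List.splitBy_append, List.flatMap_append]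
  simp [h]

theorem left_shape (n : ℕ) : ∃ w, lookAndSay^[n+1] ([3] : List ℕ+) = (w ++ [1]) ++ [3] := by
  induction n with
  | zero => exact ⟨[], by decide⟩
  | succ n ih =>
    obtain ⟨w, hw⟩ := ih
    refine ⟨lookAndSay (w ++ [1]), ?_⟩
    rw [Function.iterate_succ_apply', hw, lookAndSay_append_s11 w [] 1 3 (by decide)]
    have : lookAndSay [3] = [1, 3] := by decide
    rw [this]; simp

theorem left_last (n : ℕ) : ∃ w, lookAndSay^[n] ([3] : List ℕ+) = w ++ [3] := by
  cases n with
  | zero => exact ⟨[], rfl⟩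
  | succ n => obtain ⟨w, hw⟩ := left_shape n; exact ⟨_, hw⟩

theorem stepA (t : List ℕ+) :
    ∃ s, lookAndSay ([2, 2, 1, 3, 2, 1] ++ t) = [2, 2, 1, 1, 1, 3, 1, 2] ++ s := by
  have h := lookAndSay_append_s11 [2, 2, 1, 3] t 2 1 (by decide)
  have e : lookAndSay ([2, 2, 1, 3] ++ [2]) = [2, 2, 1, 1, 1, 3, 1, 2] := by decide
  rw [e] at h
  exact ⟨_, h⟩

theorem stepB (t : List ℕ+) :
    ∃ s, lookAndSay ([2, 2, 1, 1, 1, 3, 1, 2] ++ t) = [2, 2, 3, 1, 1, 3] ++ s := by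
  have h := lookAndSay_append_s11 [2, 2, 1, 1, 1, 3] t 1 2 (by decide)
  have e : lookAndSay ([2, 2, 1, 1, 1, 3] ++ [1]) = [2, 2, 3, 1, 1, 3, 1, 1] := by decide
  rw [e] at h
  exact ⟨_, h⟩

theorem stepC (t : List ℕ+) :
    ∃ s, lookAndSay ([2, 2, 3, 1, 1, 3] ++ t) = [2, 2, 1, 3, 2, 1] ++ s := by
  have h := lookAndSay_append_s11 [2, 2, 3, 1] t 1 3 (by decide)
  have e : lookAndSay ([2, 2, 3, 1] ++ [1]) = [2, 2, 1, 3, 2, 1] := by decide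
  rw [e] at h
  exact ⟨_, h⟩

theorem right_shape (n : ℕ) : ∃ s,
    lookAndSay^[n + 3] ([2, 2, 1, 2] : List ℕ+) = [2, 2, 1, 3, 2, 1] ++ s ∨
    lookAndSay^[n + 3] ([2, 2, 1, 2] : List ℕ+) = [2, 2, 1, 1, 1, 3, 1, 2] ++ s ∨
    lookAndSay^[n + 3] ([2, 2, 1, 2] : List ℕ+) = [2, 2, 3, 1, 1, 3] ++ s := by
  induction n with
  | zero => exact ⟨[1, 2], Or.inl (by decide)⟩
  | succ n ih =>
    rw [show n + 1 + 3 = (n + 3) + 1 from rfl, Function.iterate_succ_apply']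
    obtain ⟨s, h | h | h⟩ := ih
    · obtain ⟨r, hr⟩ := stepA s
      exact ⟨r, Or.inr (Or.inl (by rw [h, hr]))⟩
    · obtain ⟨r, hr⟩ := stepB s
      exact ⟨r, Or.inr (Or.inr (by rw [h, hr]))⟩
    · obtain ⟨r, hr⟩ := stepC s
      exact ⟨r, Or.inl (by rw [h, hr])⟩

theorem right_head (n : ℕ) : ∃ s, lookAndSay^[n] ([2, 2, 1, 2] : List ℕ+) = 2 :: s := by
  match n with
  | 0 => exact ⟨_, rfl⟩
  | 1 => exact ⟨[2, 1, 1, 1, 2], by decide⟩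
  | 2 => exact ⟨[2, 3, 1, 1, 2], by decide⟩
  | n + 3 =>
    obtain ⟨s, h | h | h⟩ := right_shape n <;> exact ⟨_, h⟩

/-- The word `(3,2,2,1,2)` splits as `(3) · (2,2,1,2)`. -/
theorem splits_32212 :
    ∀ n : ℕ, lookAndSay^[n] ([3, 2, 2, 1, 2] : List ℕ+) =
      lookAndSay^[n] ([3] : List ℕ+) ++ lookAndSay^[n] ([2, 2, 1, 2] : List ℕ+) := by
  intro n
  induction n with
  | zero => rfl
  | succ n ih =>
    simp only [Function.iterate_succ_apply']
    rw [ih]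
    obtain ⟨w, hw⟩ := left_last n
    obtain ⟨s, hs⟩ := right_head n
    rw [hw, hs]
    exact lookAndSay_append_s11 w s 3 2 (by decide)
end

section
/- For every n ≥ 0, the first symbol of C^n((2,2,1,2)) equals 2. -/
theorem las_append (l m : List ℕ+) (h : ∀ x ∈ l.getLast?, ∀ y ∈ m.head?, x ≠ y) :
    lookAndSay (l ++ m) = lookAndSay l ++ lookAndSay m := by
  unfold lookAndSay
  rw [List.splitBy_append, List.flatMap_append]
  intro x hx y hy
  simpa using h x hx y hy

theorem step_a (t : List ℕ+) : ∃ s, lookAndSay ([2,2,1,3,2] ++ 1 :: t) = [2,2,1,1,1,3,1] ++ 2 :: s := by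
  rw [las_append _ _ (by simp)]
  exact ⟨_, rfl⟩

theorem step_b (t : List ℕ+) :
    ∃ s, lookAndSay ([2,2,1,1,1,3,1] ++ 2 :: t) = [2,2,3,1,1] ++ 3 :: s := by
  rw [las_append _ _ (by simp)]
  exact ⟨_, rfl⟩

theorem step_c (t : List ℕ+) : ∃ s, lookAndSay ([2,2,3,1,1] ++ 3 :: t) = [2,2,1,3,2] ++ 1 :: s := by
  rw [las_append _ _ (by simp)]
  exact ⟨_, rfl⟩

theorem iter_form (n : ℕ) : ∃ s : List ℕ+,
    lookAndSay^[n + 3] ([2, 2, 1, 2] : List ℕ+) = [2,2,1,3,2] ++ 1 :: s ∨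
    lookAndSay^[n + 3] ([2, 2, 1, 2] : List ℕ+) = [2,2,1,1,1,3,1] ++ 2 :: s ∨
    lookAndSay^[n + 3] ([2, 2, 1, 2] : List ℕ+) = [2,2,3,1,1] ++ 3 :: s := by
  induction n with
  | zero => exact ⟨[1, 2], Or.inl (by decide)⟩
  | succ n ih =>
    obtain ⟨s, h⟩ := ih
    rw [show n + 1 + 3 = (n + 3) + 1 by omega, Function.iterate_succ_apply']
    rcases h with h | h | h <;> rw [h]
    · obtain ⟨u, hu⟩ := step_a s
      exact ⟨u, Or.inr (Or.inl hu)⟩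
    · obtain ⟨u, hu⟩ := step_b s
      exact ⟨u, Or.inr (Or.inr hu)⟩
    · obtain ⟨u, hu⟩ := step_c s
      exact ⟨u, Or.inl hu⟩

/-- Every derivation of the word `(2,2,1,2)` starts with the symbol `2`. -/
theorem head_iterate_2212 (n : ℕ) :
    (lookAndSay^[n] ([2, 2, 1, 2] : List ℕ+)).head? = some 2 := by
  match n with
  | 0 => decide
  | 1 => decide
  | 2 => decide
  | n + 3 =>
    obtain ⟨s, h | h | h⟩ := iter_form n <;> rw [h] <;> rfl
end

section
/- Cosmological Theorem (common elements): there exists a set E of at most 92 atoms, each a word over the alphabet {1,2,3}, such that for every nonempty word x over {1,2,3} containing no four consecutive equal symbols and every n ≥ 24, every atomic factor of C^n(x) belongs to E. -/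
/-- `u` is an atomic factor of `x`: it occurs in a splitting of `x` into atoms. -/
def AtomicFactor (u x : List ℕ+) : Prop :=
  ∃ us : List (List ℕ+), (∀ w ∈ us, IsAtomWord w) ∧ SplitsInto x us ∧ u ∈ us

/-- A day-one word: one containing no four consecutive equal symbols. -/
def DayOne (x : List ℕ+) : Prop := ∀ a : ℕ+, ¬ [a, a, a, a] <:+: x

namespace LS

/-! ### Computational part: words over a three letter alphabet -/

/-- The three letters `1, 2, 3`. -/
inductive D
  | one
  | two
  | three

noncomputable def deq (x y : D) : Bool :=
  D.rec (D.rec true false false y) (D.rec false true false y) (D.rec false false true y) x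

noncomputable def orB (x y : Bool) : Bool := Bool.rec y true x
noncomputable def andB (x y : Bool) : Bool := Bool.rec false y x
noncomputable def notB (x : Bool) : Bool := Bool.rec true false x

/-- the first letter of `r` (if any) is not `a` -/
noncomputable def headNe (a : D) (r : List D) : Bool :=
  List.rec (motive := fun _ => Bool) true (fun x _ _ => notB (deq x a)) r

/-- `k` copies of `a` in front of `t` -/
noncomputable def rep (k a : D) (t : List D) : List D :=
  D.rec (a :: t) (a :: a :: t) (a :: a :: a :: t) k

/-- Auxiliary function for `okR`; the flag says that the next letter is a count. -/
noncomputable def okF (r : List D) : Bool → D → Bool :=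
  List.rec (motive := fun _ => Bool → D → Bool) (fun _ _ => true)
   (fun x _ ih ph v => Bool.rec (Bool.rec (ih true x) false (deq x v)) (ih false v) ph) r

/-- In the reversed said word `r` (value, count, value, count, ...) adjacent values differ. -/
noncomputable def okR (r : List D) : Bool :=
  List.rec (motive := fun _ => Bool) true (fun x t _ => okF t true x) r

noncomputable def decF (r : List D) : Bool → D → List D :=
  List.rec (motive := fun _ => Bool → D → List D) (fun ph v => Bool.rec [] [v] ph)
   (fun x _ ih ph v => Bool.rec (ih true x) (rep x v (ih false v)) ph) r

/-- Decode a reversed said word. -/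
noncomputable def decR (r : List D) : List D := decF r false D.one

noncomputable def evenF (r : List D) : Bool → Bool :=
  List.rec (motive := fun _ => Bool → Bool) (fun ph => ph)
   (fun _ _ ih ph => Bool.rec (ih true) (ih false) ph) r

noncomputable def evenLen (r : List D) : Bool := evenF r true

/-- no four equal letters in a row -/
noncomputable def no4 : List D → Bool
  | x :: y :: z :: w :: t =>
    andB (orB (notB (deq x y)) (orB (notB (deq y z)) (notB (deq z w)))) (no4 (y :: z :: w :: t))
  | _ => true

/-- A necessary condition for the reversal of `r` to be a factor (a prefix if `left`) of
a `j`-th iterate. -/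
noncomputable def legal (left : Bool) (j : ℕ) : List D → Bool :=
  Nat.rec (motive := fun _ => List D → Bool) no4
   (fun _ ih r =>
     List.rec (motive := fun _ => Bool) true (fun c t _ =>
      List.rec (motive := fun _ => Bool) true (fun _ _ _ =>
      orB (andB (Bool.rec true (evenLen r) left) (andB (okR r) (ih (decR r))))
      (andB (Bool.rec true (evenLen t) left) (andB (okR t)
        (orB (andB (headNe D.one t) (ih (rep c D.one (decR t))))
        (orB (andB (headNe D.two t) (ih (rep c D.two (decR t))))
         (andB (headNe D.three t) (ih (rep c D.three (decR t)))))))))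
       t) r) j

/-- Recognise (in reversed words) that a cut `2|z` has just been completed. -/
noncomputable def cut : List D → Option (List D)
  | y :: x :: p :: q :: t =>
    bif andB (deq q .two) (andB (notB (deq x p)) (andB (notB (deq y x)) (notB (deq p .two))))
    then some (q :: t)
    else
      match t with
      | [] => none
      | s :: t =>
        bif andB (deq s .two) (andB (notB (deq y x)) (andB (deq x p)
          (orB (andB (deq q .one) (deq x .one)) (andB (deq q .three) (notB (deq x .three))))))
        then some (s :: t) else none
  | _ => none

/-- Search through all legal continuations until the next cut. -/
noncomputable def dfs (left : Bool) (b : ℕ) (good : List D → Bool) : ℕ → List D → List D → Bool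
  | 0, _, _ => false
  | f + 1, r, rl =>
    let go := fun c =>
      orB (notB (legal left b (c :: rl)))
      (match cut (c :: r) with
      | some m => good m
      | none => dfs left b good f (c :: r) (c :: rl))
    andB (go .one) (andB (go .two) (go .three))

/-- Reversed prefixes that guarantee a cut after a `2`. -/
def pats : List (List D) :=
  [[.one, .two, .one], [.three, .two, .one], [.one, .three, .one], [.two, .three, .one],
   [.two, .one, .one, .one], [.three, .one, .one, .one],
   [.two, .one, .three], [.three, .one, .three], [.one, .two, .three], [.three, .two, .three],
   [.two, .one, .one, .three], [.three, .one, .one, .three],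
   [.one, .two, .two, .three], [.three, .two, .two, .three]]

/-- `sayF t v k` : what is said when `k` copies of `v` have been read already. -/
noncomputable def sayF : List D → D → D → List D
  | [], v, k => [k, v]
  | x :: t, v, k =>
    bif deq x v then sayF t v (D.rec D.two D.three D.three k) else k :: v :: sayF t x .one

noncomputable def sayD : List D → List D
  | [] => []
  | x :: t => sayF t x .one

/-- The first letter of the iterates of `z` is never `2`. -/
noncomputable def n2 : List D → Bool
  | .one :: .one :: .one :: t => headNe .one t
  | .one :: .one :: _ => false
  | .one :: x :: t => headNe x t
  | [.three] => true
  | .three :: .three :: _ => false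
  | .three :: x :: y :: t => orB (notB (deq x y)) (headNe x t)
  | .three :: [_] => true
  | _ => false

/-- A cut between a word ending in `l` and the word `z`. -/
noncomputable def cutE (l : D) (z : List D) : Bool :=
  match l with
  | .two => n2 z
  | _ =>
    match z with
    | [.two, .two] => true
    | .two :: .two :: z => n2 z
    | _ => false

/-- Split a word, where the piece `l :: cur` (reversed) has been read. -/
noncomputable def piecesF : List D → D → List D → List (List D)
  | [], l, cur => [(l :: cur).reverse]
  | x :: t, l, cur =>
    bif cutE l (x :: t) then (l :: cur).reverse :: piecesF t x [] else piecesF t x (l :: cur)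

noncomputable def pieces : List D → List (List D)
  | [] => []
  | x :: t => piecesF t x []

noncomputable def strip (c : D) : List D → Option (List D)
  | [] => none
  | x :: t => bif deq x c then some t else none

noncomputable def memE : List D → List (List D) → Bool
  | [], es => es.any List.isEmpty
  | c :: w, es => memE w (es.filterMap (strip c))

def ofCode : ℕ → ℕ → List D → List D
  | 0, _, acc => acc
  | f + 1, n, acc =>
    match n % 10 with
    | 1 => ofCode f (n / 10) (.one :: acc)
    | 2 => ofCode f (n / 10) (.two :: acc)
    | 3 => ofCode f (n / 10) (.three :: acc)
    | _ => acc

/-- The 92 common elements, written as decimal numbers. -/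
def elemCodes : List ℕ := [
  3,
  12,
  13,
  22,
  132,
  312,
  1112,
  1113,
  3112,
  3113,
  11131,
  11132,
  13211,
  31132,
  32112,
  111312,
  131112,
  132112,
  132113,
  311311,
  311312,
  311332,
  1112133,
  1113222,
  1321132,
  1322112,
  1322113,
  3112112,
  3112221,
  11131221,
  11133112,
  13122112,
  13211312,
  13211321,
  31131112,
  123222112,
  123222113,
  311311222,
  1113122112,
  1113122113,
  1113222112,
  1113222113,
  1321122112,
  1321131112,
  1321133112,
  3113112211,
  3113322112,
  3113322113,
  13221133112,
  111213322112,
  111213322113,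
  111311222112,
  111312211312,
  132113212221,
  311311222112,
  311311222113,
  1322113312211,
  11131221131112,
  11131221131211,
  11131221133112,
  11131221222112,
  31121123222112,
  31121123222113,
  311322113212221,
  3113112211322112,
  3113112221131112,
  3113112221133112,
  13221133122211332,
  111312211312113211,
  132112211213322112,
  132112211213322113,
  311311222113111221,
  13211321222113222112,
  13211322211312113211,
  132211331222113112211,
  12322211331222113112211,
  31131122211311122113222,
  111312212221121123222112,
  111312212221121123222113,
  311311222113111221131221,
  11131221131211322113322112,
  312211322212221121123222112,
  312211322212221121123222113,
  1113122113322113111221131221,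
  3113112211322112211213322112,
  3113112211322112211213322113,
  13112221133211322112211213322112,
  13112221133211322112211213322113,
  1321132122211322212221121123222112,
  1321132122211322212221121123222113,
  111312211312113221133211322112211213322112,
  111312211312113221133211322112211213322113]

/-- The 92 common elements. -/
def elems : List (List D) := elemCodes.map fun n => ofCode 50 n []

noncomputable def good : ℕ → List D → Bool
  | 0, w => (pieces w).all fun t => memE t elems
  | f + 1, w => (pieces w).all fun t => orB (memE t elems) (andB (no4 t) (good f (sayD t)))

/-- Some iterate of `z` begins with `l`. -/
noncomputable def hits (l : D) : ℕ → List D → Bool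
  | 0, _ => false
  | f + 1, z => orB (notB (headNe l z)) (hits l f (sayD z))

noncomputable def atomF : List D → D → Bool
  | [], _ => true
  | x :: t, l => andB (hits l 30 (x :: t)) (atomF t x)

noncomputable def atomB : List D → Bool
  | [] => false
  | x :: t => andB (no4 (x :: t)) (atomF t x)

set_option maxRecDepth 100000


/-! ### Basic facts on the derivation -/

section Basic

local notation "C" => lookAndSay

theorem C_nil : C [] = [] := by simp [lookAndSay]

theorem C_append {u v : List ℕ+} (h : ∀ a ∈ u.getLast?, a ∉ v.head?) : C (u ++ v) = C u ++ C v := by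
  unfold lookAndSay
  rw [List.splitBy_append, List.flatMap_append]
  intro x hx y hy
  rw [beq_eq_false_iff_ne]
  rintro rfl
  exact h _ hx hy

theorem C_replicate (k : ℕ) (a : ℕ+) : C (List.replicate (k + 1) a) = [k.succPNat, a] := by
  unfold lookAndSay
  rw [List.splitBy_of_isChain]
  · simp [List.replicate_succ]
    rfl
  · simp
  · simp only [beq_iff_eq]
    exact List.isChain_replicate_of_rel _ rfl

theorem C_run (k : ℕ) (a : ℕ+) (t : List ℕ+) (h : a ∉ t.head?) :
    C (List.replicate (k + 1) a ++ t) = k.succPNat :: a :: C t := by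
  rw [C_append, C_replicate]
  · rfl
  · intro b hb
    have : a = b := by simpa [List.getLast?_replicate] using hb
    subst this
    exact h

/-- every word is empty or starts with a maximal run -/
theorem run_cases (x : List ℕ+) : x = [] ∨ ∃ (k : ℕ) (a : ℕ+) (t : List ℕ+),
    x = List.replicate (k + 1) a ++ t ∧ a ∉ t.head? := by
  induction x with
  | nil => left; rfl
  | cons b s ih =>
    right
    rcases ih with rfl | ⟨k, a, t, rfl, h⟩
    · exact ⟨0, b, [], by simp, by simp⟩
    · by_cases hab : b = a
      · subst hab
        exact ⟨k + 1, b, t, by simp [List.replicate_succ], h⟩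
      · refine ⟨0, b, List.replicate (k + 1) a ++ t, by simp, ?_⟩
        simp [List.replicate_succ, Ne.symm hab]

theorem run_induction {P : List ℕ+ → Prop} (h0 : P [])
    (h1 : ∀ k a t, a ∉ t.head? → P t → P (List.replicate (k + 1) a ++ t)) (x : List ℕ+) : P x := by
  induction hn : x.length using Nat.strong_induction_on generalizing x with
  | _ n ih =>
    rcases run_cases x with rfl | ⟨k, a, t, rfl, h⟩
    · exact h0
    · refine h1 k a t h (ih t.length ?_ t rfl)
      rw [← hn]; simp

theorem C_eq_nil {x : List ℕ+} : C x = [] ↔ x = [] := by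
  rcases run_cases x with rfl | ⟨k, a, t, rfl, h⟩
  · simp [C_nil]
  · rw [C_run _ _ _ h]; simp

theorem C_iter_eq_nil {x : List ℕ+} (n : ℕ) : C^[n] x = [] ↔ x = [] := by
  induction n with
  | zero => rfl
  | succ n ih => rw [Function.iterate_succ_apply', C_eq_nil, ih]

theorem C_iter_nil (n : ℕ) : C^[n] [] = [] := (C_iter_eq_nil n).2 rfl

theorem C_getLast? (x : List ℕ+) : (C x).getLast? = x.getLast? := by
  induction x using run_induction with
  | h0 => simp [C_nil]
  | h1 k a t h ih =>
    rw [C_run _ _ _ h]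
    rcases eq_or_ne t [] with rfl | ht
    · simp [C_nil, List.getLast?_replicate]
    · have h2 : C t ≠ [] := by rwa [Ne, C_eq_nil]
      rw [List.getLast?_append_of_ne_nil _ ht, ← ih]
      rw [show k.succPNat :: a :: C t = [k.succPNat, a] ++ C t from rfl,
        List.getLast?_append_of_ne_nil _ h2]

theorem C_iter_getLast? (n : ℕ) (x : List ℕ+) : (C^[n] x).getLast? = x.getLast? := by
  induction n with
  | zero => rfl
  | succ n ih => rw [Function.iterate_succ_apply', C_getLast?, ih]

/-- merging two equal letters at the junction shortens the derived word -/
theorem C_append_bad {u v : List ℕ+} {a : ℕ+} (hu : a ∈ u.getLast?) (hv : a ∈ v.head?) :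
    (C (u ++ v)).length < (C u).length + (C v).length := by
  induction u using run_induction with
  | h0 => simp at hu
  | h1 k b t h ih =>
    rcases eq_or_ne t [] with rfl | ht
    · have : b = a := by simpa [List.getLast?_replicate] using hu
      subst this
      rcases run_cases v with rfl | ⟨m, c, s, rfl, h2⟩
      · simp at hv
      · have : c = b := by simpa [List.replicate_succ] using hv
        subst this
        rw [List.append_nil, ← List.append_assoc, ← List.replicate_add, C_replicate,
          show k + 1 + (m + 1) = (k + m + 1) + 1 by ring, C_run _ _ _ h2, C_run _ _ _ h2]
        simp
    · rw [List.getLast?_append_of_ne_nil _ ht] at hu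
      have := ih hu
      have h3 : b ∉ (t ++ v).head? := by
        rw [List.head?_append_of_ne_nil _ ht]; exact h
      rw [List.append_assoc, C_run _ _ _ h3, C_run _ _ _ h]
      simp only [List.length_cons]; omega

theorem C_append_iff {u v : List ℕ+} :
    (C (u ++ v)).length = (C u).length + (C v).length ↔ ∀ a ∈ u.getLast?, a ∉ v.head? := by
  constructor
  · intro h a ha hv
    have := C_append_bad ha hv
    omega
  · intro h; rw [C_append h, List.length_append]

theorem C_length_append (u v : List ℕ+) :
    (C (u ++ v)).length ≤ (C u).length + (C v).length := by
  by_cases h : ∀ a ∈ u.getLast?, a ∉ v.head?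
  · exact (C_append_iff.2 h).le
  · push Not at h
    obtain ⟨a, h1, h2⟩ := h
    exact (C_append_bad h1 h2).le

theorem C_length_flatten (ws : List (List ℕ+)) :
    (C ws.flatten).length ≤ (ws.map C).flatten.length := by
  induction ws with
  | nil => simp [C_nil]
  | cons w ws ih =>
    have := C_length_append w ws.flatten
    simp only [List.flatten_cons, List.map_cons, List.length_append]
    omega

/-! ### Cuts -/

/-- `u` and `v` never interact -/
def Cut (u v : List ℕ+) : Prop := ∀ n : ℕ, C^[n] (u ++ v) = C^[n] u ++ C^[n] v

theorem cut_iff {u v : List ℕ+} : Cut u v ↔ ∀ a ∈ u.getLast?, ∀ n, a ∉ (C^[n] v).head? := by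
  constructor
  · intro h a ha n
    have h1 := h (n + 1)
    rw [Function.iterate_succ_apply', h n, Function.iterate_succ_apply',
      Function.iterate_succ_apply'] at h1
    have h2 := congrArg List.length h1
    rw [List.length_append] at h2
    exact C_append_iff.1 h2 a (by rwa [C_iter_getLast?])
  · intro h n
    induction n with
    | zero => rfl
    | succ n ih =>
      rw [Function.iterate_succ_apply', ih, C_append, Function.iterate_succ_apply',
        Function.iterate_succ_apply']
      intro a ha
      rw [C_iter_getLast?] at ha
      exact h a ha n

theorem cut_nil_left (v : List ℕ+) : Cut [] v := by
  rw [cut_iff]; simp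

theorem cut_nil_right (v : List ℕ+) : Cut v [] := by
  rw [cut_iff]; simp [C_iter_nil]

theorem cut_congr_left {u u' v : List ℕ+} (h : u.getLast? = u'.getLast?) : Cut u v ↔ Cut u' v := by
  rw [cut_iff, cut_iff, h]

theorem cut_append_left {u u' v : List ℕ+} (h : u' ≠ []) : Cut (u ++ u') v ↔ Cut u' v :=
  cut_congr_left (List.getLast?_append_of_ne_nil _ h)

theorem cut_append_right {u v w : List ℕ+} (hv : v ≠ []) (h : Cut v w) :
    Cut u (v ++ w) ↔ Cut u v := by
  rw [cut_iff, cut_iff]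
  have : ∀ n, (C^[n] (v ++ w)).head? = (C^[n] v).head? := by
    intro n
    rw [h n, List.head?_append_of_ne_nil]
    rwa [Ne, C_iter_eq_nil]
  simp only [this]

theorem Cut.iter {u v : List ℕ+} (h : Cut u v) (m : ℕ) : Cut (C^[m] u) (C^[m] v) := by
  intro n
  rw [← h m, ← Function.iterate_add_apply, ← Function.iterate_add_apply,
    ← Function.iterate_add_apply, h]

theorem splitsInto_cons {x u : List ℕ+} {us : List (List ℕ+)} (h : SplitsInto x (u :: us)) :
    Cut u us.flatten ∧ SplitsInto us.flatten us := by
  obtain ⟨rfl, h⟩ := h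
  have key : ∀ n, C^[n] us.flatten = (us.map fun u => C^[n] u).flatten := by
    intro n
    induction n with
    | zero => simp
    | succ n ih =>
      have h0 := h n
      have h1 := h (n + 1)
      simp only [List.flatten_cons, List.map_cons] at h0 h1
      rw [Function.iterate_succ_apply', h0, ← ih] at h1
      have h2 := C_length_append (C^[n] u) (C^[n] us.flatten)
      have h3 := C_length_flatten (us.map fun u => C^[n] u)
      have h5 : (List.map C (us.map fun u => C^[n] u)) = us.map fun u => C^[n+1] u := by
        simp [Function.iterate_succ_apply']
      rw [← ih, h5] at h3
      have h4 := congrArg List.length h1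
      rw [List.length_append, Function.iterate_succ_apply'] at h4
      have h6 := (C_append_iff (u := C^[n] u) (v := C^[n] us.flatten)).1 (by omega)
      rw [C_append h6, Function.iterate_succ_apply'] at h1
      rw [Function.iterate_succ_apply']
      exact List.append_cancel_left h1
  refine ⟨fun n => ?_, rfl, key⟩
  have h0 := h n
  simp only [List.flatten_cons, List.map_cons] at h0
  rw [h0, key]

/-! ### Words composed of elements of a set `E` -/

inductive Elem (E : List ℕ+ → Prop) : List ℕ+ → Prop
  | nil : Elem E []
  | cons {e t : List ℕ+} : E e → Elem E t → Cut e t → Elem E (e ++ t)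

variable {E : List ℕ+ → Prop}

theorem Elem.single {e : List ℕ+} (h : E e) : Elem E e := by
  have := Elem.cons h Elem.nil (cut_nil_right e)
  simpa using this

theorem Elem.append {A B : List ℕ+} (hA : Elem E A) (hB : Elem E B) (h : Cut A B) :
    Elem E (A ++ B) := by
  induction hA with
  | nil => simpa using hB
  | @cons e t he ht hc ih =>
    rcases eq_or_ne t [] with rfl | hne
    · rw [List.append_nil] at h ⊢
      exact Elem.cons he hB h
    · rw [cut_append_left hne] at h
      rw [List.append_assoc]
      exact Elem.cons he (ih h) ((cut_append_right hne h).2 hc)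

theorem Elem.of_cut (hE : ∀ e, E e → IsAtomWord e) {X : List ℕ+} (hX : Elem E X) :
    ∀ {A B : List ℕ+}, X = A ++ B → Cut A B → Elem E A ∧ Elem E B := by
  induction hX with
  | nil =>
    intro A B h _
    obtain ⟨rfl, rfl⟩ := List.append_eq_nil_iff.1 h.symm
    exact ⟨Elem.nil, Elem.nil⟩
  | @cons e t he ht hc ih =>
    intro A B h hAB
    rcases List.append_eq_append_iff.1 h with ⟨A', rfl, rfl⟩ | ⟨M, rfl, rfl⟩
    · rcases eq_or_ne A' [] with rfl | hne
      · simp only [List.append_nil, List.nil_append] at *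
        exact ⟨Elem.single he, ht⟩
      · rw [cut_append_left hne] at hAB
        obtain ⟨h1, h2⟩ := ih rfl hAB
        exact ⟨Elem.cons he h1 ((cut_append_right hne hAB).1 hc), h2⟩
    · rcases eq_or_ne M [] with rfl | hne
      · simp only [List.append_nil, List.nil_append] at *
        exact ⟨Elem.single he, ht⟩
      · rcases eq_or_ne A [] with rfl | hA
        · exact ⟨Elem.nil, Elem.cons he ht hc⟩
        · exfalso
          rw [cut_append_left hne] at hc
          rw [cut_append_right hne hc] at hAB
          exact (hE _ he).2 ⟨A, M, hA, hne, rfl, hAB⟩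

theorem Elem.atom {u : List ℕ+} (hu : Elem E u) (ha : IsAtomWord u)
    (hE : ∀ e, E e → IsAtomWord e) : E u := by
  cases hu with
  | nil => exact absurd rfl ha.1
  | @cons e t he ht hc =>
    rcases eq_or_ne t [] with rfl | hne
    · simpa using he
    · exact absurd ⟨e, t, (hE _ he).1, hne, rfl, hc⟩ ha.2

theorem Elem.atomicFactor (hE : ∀ e, E e → IsAtomWord e) {x : List ℕ+} (hx : Elem E x)
    {us : List (List ℕ+)} (ha : ∀ w ∈ us, IsAtomWord w) (hs : SplitsInto x us) :
    ∀ u ∈ us, E u := by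
  induction us generalizing x with
  | nil => simp
  | cons w ws ih =>
    have hxe := hs.1
    obtain ⟨h1, h2⟩ := splitsInto_cons hs
    obtain ⟨h3, h4⟩ := hx.of_cut hE (by simpa using hxe) h1
    intro u hu
    rcases List.mem_cons.1 hu with rfl | hu
    · exact h3.atom (ha _ (by simp)) hE
    · exact ih h4 (fun w hw => ha w (by simp [hw])) h2 u hu

theorem Elem.derive (hC : ∀ e, E e → Elem E (C e)) {x : List ℕ+} (hx : Elem E x) :
    Elem E (C x) := by
  induction hx with
  | nil => rw [C_nil]; exact Elem.nil
  | @cons e t he ht hc ih =>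
    have := hc 1
    simp only [Function.iterate_one] at this
    rw [this]
    exact (hC e he).append ih (hc.iter 1)

theorem Elem.iter (hC : ∀ e, E e → Elem E (C e)) {x : List ℕ+} (hx : Elem E x) (n : ℕ) :
    Elem E (C^[n] x) := by
  induction n with
  | zero => exact hx
  | succ n ih => rw [Function.iterate_succ_apply']; exact ih.derive hC

/-- `Good E f w` : after `f` steps `w` is composed of elements. -/
def Good (E : List ℕ+ → Prop) (f : ℕ) (w : List ℕ+) : Prop := Elem E (C^[f] w)

theorem Good.append {f : ℕ} {A B : List ℕ+} (hA : Good E f A) (hB : Good E f B) (h : Cut A B) :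
    Good E f (A ++ B) := by
  unfold Good
  rw [h f]
  exact Elem.append hA hB (h.iter f)

theorem Good.of_cut (hE : ∀ e, E e → IsAtomWord e) {f : ℕ} {A B : List ℕ+}
    (hX : Good E f (A ++ B)) (h : Cut A B) : Good E f A ∧ Good E f B :=
  Elem.of_cut hE hX (h f) (h.iter f)

/-! ### The cut rules -/

/-- A class of words no iterate of which begins with `2`. -/
inductive N2 : List ℕ+ → Prop
  | cA (x : ℕ+) (t : List ℕ+) : x ≠ 1 → x ∉ t.head? → N2 (1 :: x :: t)
  | cB (t : List ℕ+) : 1 ∉ t.head? → N2 (1 :: 1 :: 1 :: t)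
  | cC0 : N2 [3]
  | cC1 (x : ℕ+) (t : List ℕ+) : x ≠ 3 → x ∉ t.head? → N2 (3 :: x :: t)
  | cC2 (x : ℕ+) (t : List ℕ+) : x ≠ 3 → x ∉ t.head? → N2 (3 :: x :: x :: t)

theorem C_run1 {a : ℕ+} {t : List ℕ+} (h : a ∉ t.head?) : C (a :: t) = 1 :: a :: C t :=
  C_run 0 a t h

theorem C_run2 {a : ℕ+} {t : List ℕ+} (h : a ∉ t.head?) : C (a :: a :: t) = 2 :: a :: C t :=
  C_run 1 a t h

theorem C_run3 {a : ℕ+} {t : List ℕ+} (h : a ∉ t.head?) : C (a :: a :: a :: t) = 3 :: a :: C t :=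
  C_run 2 a t h

theorem N2.derive {z : List ℕ+} (h : N2 z) : N2 (C z) := by
  cases h with
  | cA x t h1 h2 =>
    rw [C_run1 (by simpa using h1), C_run1 h2]
    exact N2.cB _ (by simpa using h1)
  | cB t h1 =>
    rw [C_run3 h1]
    rcases run_cases t with rfl | ⟨k, a, s, rfl, h⟩
    · rw [C_nil]; exact N2.cC1 _ _ (by decide) (by simp)
    · rw [C_run _ _ _ h]
      have ha : a ≠ 1 := by simpa [List.replicate_succ] using h1
      by_cases hk : k.succPNat = 1
      · rw [hk]; exact N2.cC2 _ _ (by decide) (by simpa using ha)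
      · exact N2.cC1 _ _ (by decide) (by simpa using hk)
  | cC0 =>
    rw [C_run1 (by simp), C_nil]
    exact N2.cA _ _ (by decide) (by simp)
  | cC1 x t h1 h2 =>
    rw [C_run1 (by simpa using h1), C_run1 h2]
    exact N2.cA _ _ (by decide) (by simp)
  | cC2 x t h1 h2 =>
    rw [C_run1 (by simpa using h1), C_run2 h2]
    exact N2.cA _ _ (by decide) (by simp)

theorem N2.head {z : List ℕ+} (h : N2 z) : 2 ∉ z.head? := by
  cases h <;> simp

theorem N2.iter {z : List ℕ+} (h : N2 z) (n : ℕ) : N2 (C^[n] z) := by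
  induction n with
  | zero => exact h
  | succ n ih => rw [Function.iterate_succ_apply']; exact ih.derive

theorem N2.cut {u z : List ℕ+} (h : N2 z) (hu : u.getLast? = some 2) : Cut u z := by
  rw [cut_iff, hu]
  intro a ha n
  have : 2 = a := by simpa using ha
  subst this
  exact (h.iter n).head

/-- words that may follow `22` -/
def After22 (z : List ℕ+) : Prop := z = [] ∨ N2 z

theorem After22.head {z : List ℕ+} (h : After22 z) : 2 ∉ z.head? := by
  rcases h with rfl | h
  · simp
  · exact h.head

theorem After22.derive {z : List ℕ+} (h : After22 z) : After22 (C z) := by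
  rcases h with rfl | h
  · left; exact C_nil
  · right; exact h.derive

theorem After22.iter {z : List ℕ+} (h : After22 z) (n : ℕ) :
    ∃ z', After22 z' ∧ C^[n] (2 :: 2 :: z) = 2 :: 2 :: z' := by
  induction n with
  | zero => exact ⟨z, h, rfl⟩
  | succ n ih =>
    obtain ⟨z', h1, h2⟩ := ih
    exact ⟨C z', h1.derive, by rw [Function.iterate_succ_apply', h2, C_run2 h1.head]⟩

theorem After22.cut {u z : List ℕ+} (h : After22 z) (hu : 2 ∉ u.getLast?) :
    Cut u (2 :: 2 :: z) := by
  rw [cut_iff]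
  intro a ha n
  obtain ⟨z', _, h2⟩ := h.iter n
  rw [h2]
  rintro h3
  have : 2 = a := by simpa using h3
  subst this
  exact hu ha

end Basic

/-! ### Bridging between the computational part and the abstract part -/

section Bridge

local notation "C" => lookAndSay

/-- the letter as a positive integer -/
def val : D → ℕ+
  | .one => 1
  | .two => 2
  | .three => 3

/-- the letter minus one -/
def num : D → ℕ
  | .one => 0
  | .two => 1
  | .three => 2

/-- a word over `D` as a word over the positive integers -/
def emb (w : List D) : List ℕ+ := w.map val

theorem val_inj : Function.Injective val := by
  intro a b h
  cases a <;> cases b <;> first | rfl | exact absurd h (by decide)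

theorem val_num (k : D) : (num k).succPNat = val k := by cases k <;> rfl

theorem emb_inj : Function.Injective emb := List.map_injective_iff.2 val_inj

theorem emb_append (u v : List D) : emb (u ++ v) = emb u ++ emb v := List.map_append

theorem emb_cons (a : D) (v : List D) : emb (a :: v) = val a :: emb v := rfl

theorem emb_nil : emb [] = [] := rfl

theorem emb_eq_nil {v : List D} : emb v = [] ↔ v = [] := List.map_eq_nil_iff

theorem emb_length (v : List D) : (emb v).length = v.length := List.length_map _

theorem emb_head {a : D} {v : List D} : val a ∈ (emb v).head? ↔ a ∈ v.head? := by
  cases v with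
  | nil => simp [emb]
  | cons b v => simp [emb, val_inj.eq_iff]

theorem emb_getLast {a : D} {v : List D} : val a ∈ (emb v).getLast? ↔ a ∈ v.getLast? := by
  unfold emb
  rw [List.getLast?_map]
  simp [val_inj.eq_iff]

theorem emb_getLast? (v : List D) : (emb v).getLast? = v.getLast?.map val := List.getLast?_map

theorem deq_iff {a b : D} : deq a b = true ↔ a = b := by
  cases a <;> cases b <;> simp [deq]

theorem or_eq (x y : Bool) : orB x y = (x || y) := by cases x <;> rfl
theorem and_eq (x y : Bool) : andB x y = (x && y) := by cases x <;> rfl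
theorem not_eq (x : Bool) : notB x = !x := by cases x <;> rfl

theorem not_deq_iff {a b : D} : notB (deq a b) = true ↔ a ≠ b := by
  rw [not_eq, Bool.not_eq_true', ← Bool.not_eq_true, deq_iff]

theorem headNe_iff {a : D} {t : List D} : headNe a t = true ↔ a ∉ t.head? := by
  cases t with
  | nil => simp [headNe]
  | cons b t =>
    change notB (deq b a) = true ↔ _
    rw [not_deq_iff]; simp

theorem rep_eq (k a : D) (t : List D) : rep k a t = List.replicate (num k + 1) a ++ t := by
  cases k <;> rfl

theorem rep_append (k a : D) (t u : List D) : rep k a (t ++ u) = rep k a t ++ u := by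
  cases k <;> rfl

theorem rep_head? (k a : D) (t : List D) : (rep k a t).head? = some a := by
  cases k <;> rfl

theorem okR_cons (a k : D) (t : List D) : okR (a :: k :: t) = (headNe a t && okR t) := by
  cases t with
  | nil => rfl
  | cons b t =>
    change (Bool.rec (okF t true b) false (deq b a) : Bool) = (notB (deq b a) && okF t true b)
    cases deq b a <;> rfl

theorem decR_cons (a k : D) (t : List D) : decR (a :: k :: t) = rep k a (decR t) := by
  change rep k a (decF t false a) = rep k a (decF t false D.one)
  cases t <;> rfl

theorem evenLen_cons (a k : D) (t : List D) : evenLen (a :: k :: t) = evenLen t := rfl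

/-- no four equal letters in a row -/
def No4 (y : List D) : Prop := ∀ a, ¬ [a, a, a, a] <:+: y

theorem No4.of_sub {x y : List D} (h : No4 y) (hx : x <:+: y) : No4 x :=
  fun a ha => h a (ha.trans hx)

theorem No4.reverse {y : List D} (h : No4 y) : No4 y.reverse := by
  intro a ha
  apply h a
  obtain ⟨s, t, hst⟩ := ha
  exact ⟨t.reverse, s.reverse, by rw [← List.reverse_reverse y, ← hst]; simp⟩

theorem no4_of {y : List D} (h : No4 y) : no4 y = true := by
  fun_induction no4 y with
  | case1 x y z w t ih =>
    rw [and_eq, ih (h.of_sub (List.suffix_cons _ _).isInfix), or_eq, or_eq, Bool.and_true]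
    by_contra h2
    simp only [Bool.not_eq_true, Bool.or_eq_false_iff, not_eq, Bool.not_eq_false', deq_iff] at h2
    obtain ⟨rfl, rfl, rfl⟩ := h2
    exact h x (List.prefix_append [x, x, x, x] t).isInfix
  | case2 => rfl

theorem of_no4 {y : List D} (h : no4 y = true) : No4 y := by
  fun_induction no4 y with
  | case1 x y z w t ih =>
    simp only [and_eq, or_eq, Bool.and_eq_true, Bool.or_eq_true, not_deq_iff] at h
    intro a ha
    rcases List.infix_cons_iff.1 ha with h2 | h2
    · simp only [List.cons_prefix_cons] at h2
      obtain ⟨rfl, rfl, rfl, rfl, -⟩ := h2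
      simp at h
    · exact ih h.2 a h2
  | case2 y hy =>
    intro a ha
    obtain ⟨s, t, rfl⟩ := ha
    match s, hy with
    | [], hy => exact hy _ _ _ _ _ rfl
    | [_], hy => exact hy _ _ _ _ _ rfl
    | [_, _], hy => exact hy _ _ _ _ _ rfl
    | [_, _, _], hy => exact hy _ _ _ _ _ rfl
    | _ :: _ :: _ :: _ :: _, hy => exact hy _ _ _ _ _ rfl

/-- `s` (reversed) is what is said when reading `y` (reversed). -/
inductive RS : List D → List D → Prop
  | nil : RS [] []
  | cons {y s : List D} (a k : D) : RS y s → headNe a y = true → RS (rep k a y) (a :: k :: s)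

theorem RS.head {y s : List D} (h : RS y s) : y.head? = s.head? := by
  cases h with
  | nil => rfl
  | cons a k h h2 => rw [rep_head?]; rfl

theorem RS.exists {y : List D} (h : No4 y) : ∃ s, RS y s := by
  induction y with
  | nil => exact ⟨_, RS.nil⟩
  | cons b y ih =>
    obtain ⟨s, hs⟩ := ih (h.of_sub (List.suffix_cons _ _).isInfix)
    cases hs with
    | nil => exact ⟨_, RS.cons b .one RS.nil rfl⟩
    | @cons y s a k h1 h2 =>
      by_cases hab : a = b
      · subst hab
        cases k with
        | one => exact ⟨_, RS.cons a .two h1 h2⟩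
        | two => exact ⟨_, RS.cons a .three h1 h2⟩
        | three =>
          exact absurd (List.prefix_append [a, a, a, a] y).isInfix (h a)
      · refine ⟨_, RS.cons b .one (RS.cons a k h1 h2) ?_⟩
        rw [headNe_iff, rep_head?]
        simpa using hab

theorem RS.ne {y : List D} {a k b : D} {t : List D} (h : RS y (a :: k :: b :: t)) : a ≠ b := by
  cases h with
  | cons a k h h2 =>
    rw [headNe_iff, h.head] at h2
    simpa using Ne.symm (by simpa using h2)

theorem RS.no4 {y s : List D} (h : RS y s) : No4 s := by
  induction h with
  | nil => intro a ha; simp at ha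
  | @cons y s a k h h2 ih =>
    intro c hc
    rcases List.infix_cons_iff.1 hc with h3 | h3
    · obtain ⟨t, ht⟩ := h3
      have h4 := RS.cons a k h h2
      rw [← ht] at h4
      exact h4.ne rfl
    · rcases List.infix_cons_iff.1 h3 with h3 | h3
      · obtain ⟨t, ht⟩ := h3
        simp only [List.cons_append, List.cons.injEq] at ht
        obtain ⟨-, rfl⟩ := ht
        exact h.ne rfl
      · exact ih c h3

theorem RS.say {y s : List D} (h : RS y s) : C (emb y.reverse) = emb s.reverse := by
  induction h with
  | nil => exact C_nil
  | @cons y s a k h h2 ih =>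
    rw [rep_eq, List.reverse_append, emb_append, C_append, ih]
    · have : emb (List.replicate (num k + 1) a).reverse = List.replicate (num k + 1) (val a) := by
        simp [emb]
      rw [this, C_replicate, val_num]
      simp [emb]
    · intro b hb hb2
      have h3 : b = val a := by
        simpa [emb, List.replicate_succ', eq_comm] using hb2
      subst h3
      rw [emb_getLast] at hb
      rw [headNe_iff] at h2
      simp at hb
      exact h2 hb

theorem RS.initial {y s : List D} (h : RS y s) : ∀ {t u : List D}, s = t ++ u →
    okR t = true ∧ ∃ u2, y = decR t ++ u2 ∧ (u = [] → u2 = [] ∧ evenLen t = true) := by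
  induction h with
  | nil =>
    intro t u h
    obtain ⟨rfl, rfl⟩ := List.append_eq_nil_iff.1 h.symm
    exact ⟨rfl, [], rfl, fun _ => ⟨rfl, rfl⟩⟩
  | @cons y s a k h h2 ih =>
    intro t u hs
    match t, hs with
    | [], hs =>
      rw [List.nil_append] at hs
      subst hs
      exact ⟨rfl, _, rfl, by simp⟩
    | [b], hs =>
      simp only [List.cons_append, List.nil_append, List.cons.injEq] at hs
      obtain ⟨rfl, rfl⟩ := hs
      refine ⟨rfl, (rep k a y).tail, ?_, by simp⟩
      cases k <;> rfl
    | b :: c :: t, hs =>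
      simp only [List.cons_append, List.cons.injEq] at hs
      obtain ⟨rfl, rfl, rfl⟩ := hs
      obtain ⟨h3, u2, rfl, h5⟩ := ih rfl
      refine ⟨?_, u2, ?_, h5⟩
      · rw [okR_cons, h3, Bool.and_true]
        rw [headNe_iff, h.head] at h2
        rw [headNe_iff]
        cases t with
        | nil => simp
        | cons d t => simpa using h2
      · rw [decR_cons, rep_append]

theorem RS.factor {y s : List D} (h : RS y s) : ∀ {v r u : List D}, s = v ++ (r ++ u) → r ≠ [] →
    ∃ v2 u2, (okR r = true ∧ y = v2 ++ (decR r ++ u2) ∧ (u = [] → u2 = [] ∧ evenLen r = true)) ∨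
      ∃ c t a, r = c :: t ∧ headNe a t = true ∧ okR t = true ∧
        y = v2 ++ (rep c a (decR t) ++ u2) ∧ (u = [] → u2 = [] ∧ evenLen t = true) := by
  induction h with
  | nil =>
    intro v r u h hr
    simp at h
    exact absurd h.2.1 hr
  | @cons y s a k h h2 ih =>
    intro v r u hs hr
    match v, hs with
    | [], hs =>
      obtain ⟨h3, u2, h4, h5⟩ := (RS.cons a k h h2).initial (t := r) (u := u) hs
      exact ⟨[], u2, Or.inl ⟨h3, h4, h5⟩⟩
    | [b], hs =>
      cases r with
      | nil => exact absurd rfl hr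
      | cons c t =>
        simp only [List.cons_append, List.nil_append, List.cons.injEq] at hs
        obtain ⟨rfl, rfl, rfl⟩ := hs
        obtain ⟨h3, u2, rfl, h5⟩ := h.initial rfl
        refine ⟨[], u2, Or.inr ⟨_, _, a, rfl, ?_, h3, ?_, h5⟩⟩
        · rw [headNe_iff, h.head] at h2
          rw [headNe_iff]
          cases t with
          | nil => simp
          | cons d t => simpa using h2
        · rw [rep_append]; rfl
    | b :: c :: v, hs =>
      simp only [List.cons_append, List.cons.injEq] at hs
      obtain ⟨rfl, rfl, rfl⟩ := hs
      obtain ⟨v2, u2, h3⟩ := ih rfl hr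
      refine ⟨rep k a v2, u2, ?_⟩
      rcases h3 with ⟨h4, rfl, h5⟩ | ⟨c, t, d, hr, h4, h5, rfl, h6⟩
      · exact Or.inl ⟨h4, by rw [rep_append], h5⟩
      · exact Or.inr ⟨c, t, d, hr, h4, h5, by rw [rep_append], h6⟩

/-- `s` is the reversal of a `j`-th iterate -/
def Lev : ℕ → List D → Prop
  | 0, s => No4 s
  | j + 1, s => ∃ y, Lev j y ∧ RS y s

theorem legal_of (left : Bool) (j : ℕ) : ∀ {v r u : List D}, Lev j (v ++ (r ++ u)) →
    (left = true → u = []) → legal left j r = true := by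
  induction j with
  | zero =>
    intro v r u h _
    apply no4_of
    exact No4.of_sub h ⟨v, u, by simp⟩
  | succ j ih =>
    intro v r u h hl
    match r, h with
    | [], _ => rfl
    | [c], _ => rfl
    | c :: d :: t, h =>
      obtain ⟨y, hy, hs⟩ := h
      have hev : ∀ {b : Bool} {u2 : List D}, (u = [] → u2 = [] ∧ b = true) →
          (Bool.rec true b left : Bool) = true := by
        intro b u2 h5
        cases left with
        | false => rfl
        | true => exact (h5 (hl rfl)).2
      have hul : ∀ {b : Bool} {u2 : List D}, (u = [] → u2 = [] ∧ b = true) →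
          (left = true → u2 = []) := fun h5 hh => (h5 (hl hh)).1
      have hunf : legal left (j + 1) (c :: d :: t) =
        orB (andB (Bool.rec true (evenLen (c :: d :: t)) left)
          (andB (okR (c :: d :: t)) (legal left j (decR (c :: d :: t)))))
        (andB (Bool.rec true (evenLen (d :: t)) left) (andB (okR (d :: t))
        (orB (andB (headNe D.one (d :: t)) (legal left j (rep c D.one (decR (d :: t)))))
        (orB (andB (headNe D.two (d :: t)) (legal left j (rep c D.two (decR (d :: t)))))
         (andB (headNe D.three (d :: t)) (legal left j (rep c D.three (decR (d :: t))))))))) := rfl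
      rw [hunf]
      simp only [or_eq, and_eq, Bool.or_eq_true, Bool.and_eq_true]
      obtain ⟨v2, u2, h3⟩ := hs.factor rfl (by simp)
      rcases h3 with ⟨h4, rfl, h5⟩ | ⟨c', t', a, hr, h4, h5, rfl, h6⟩
      · exact Or.inl ⟨hev h5, h4, ih hy (hul h5)⟩
      · simp only [List.cons.injEq] at hr
        obtain ⟨rfl, rfl⟩ := hr
        refine Or.inr ⟨hev h6, h5, ?_⟩
        have h7 := ih hy (hul h6)
        cases a
        · exact Or.inl ⟨h4, h7⟩
        · exact Or.inr (Or.inl ⟨h4, h7⟩)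
        · exact Or.inr (Or.inr ⟨h4, h7⟩)

theorem Lev.exists {y : List D} (h : No4 y) (j : ℕ) :
    ∃ s, Lev j s ∧ No4 s ∧ C^[j] (emb y.reverse) = emb s.reverse := by
  induction j with
  | zero => exact ⟨y, h, h, rfl⟩
  | succ j ih =>
    obtain ⟨s, h1, h2, h3⟩ := ih
    obtain ⟨s', hs⟩ := RS.exists h2
    exact ⟨s', ⟨s, h1, hs⟩, hs.no4, by rw [Function.iterate_succ_apply', h3, hs.say]⟩

theorem sayF_spec (t : List D) : ∀ v k : D, No4 (rep k v t) →
    C (emb (rep k v t)) = emb (sayF t v k) := by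
  induction t with
  | nil =>
    intro v k _
    have : emb (rep k v []) = List.replicate (num k + 1) (val v) := by simp [rep_eq, emb]
    rw [this, C_replicate, val_num]; rfl
  | cons x t ih =>
    intro v k h
    unfold sayF
    by_cases hx : x = v
    · subst hx
      rw [deq_iff.2 rfl, cond_true]
      cases k with
      | one => exact ih x .two h
      | two => exact ih x .three h
      | three => exact absurd (List.prefix_append [x, x, x, x] t).isInfix (h x)
    · have hd : deq x v = false := by rwa [← Bool.not_eq_true, deq_iff]
      rw [hd, cond_false]
      have h1 : No4 (rep .one x t) := h.of_sub (by
        rw [rep_eq k v]; exact (List.suffix_append _ _).isInfix)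
      rw [emb_cons, emb_cons, ← ih x .one h1, rep_eq, emb_append]
      have : emb (List.replicate (num k + 1) v) = List.replicate (num k + 1) (val v) := by
        simp [emb]
      rw [this, C_run, val_num]
      · rfl
      · rw [emb_head]; simpa using hx

theorem sayD_spec {w : List D} (h : No4 w) : C (emb w) = emb (sayD w) := by
  cases w with
  | nil => exact C_nil
  | cons x t => exact sayF_spec t x .one h

theorem sayD_no4 {w : List D} (h : No4 w) : No4 (sayD w) := by
  obtain ⟨s, hs⟩ := RS.exists h.reverse
  have h1 := hs.say
  rw [List.reverse_reverse, sayD_spec h] at h1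
  rw [emb_inj h1]
  exact hs.no4.reverse

end Bridge

/-! ### Elements -/

section Elements

local notation "C" => lookAndSay

theorem headNe_emb {a : D} {t : List D} (h : headNe a t = true) : val a ∉ (emb t).head? := by
  rw [emb_head]; exact headNe_iff.1 h

theorem val_ne {a b : D} (h : a ≠ b) : val a ≠ val b := fun h2 => h (val_inj h2)

theorem n2_spec {z : List D} (h : n2 z = true) : N2 (emb z) := by
  unfold n2 at h
  split at h
  · exact N2.cB _ (headNe_emb h)
  · exact absurd h (by simp)
  · rename_i x t h1 h2
    refine N2.cA _ _ ?_ (headNe_emb h)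
    refine val_ne (b := .one) ?_
    rintro rfl
    exact h2 rfl
  · exact N2.cC0
  · exact absurd h (by simp)
  · rename_i x y t h1
    have hx : val x ≠ val .three := val_ne (by rintro rfl; exact h1 rfl)
    by_cases hxy : x = y
    · subst hxy
      rw [or_eq, Bool.or_eq_true, not_deq_iff] at h
      exact N2.cC2 _ _ hx (headNe_emb (h.resolve_left (by simp)))
    · exact N2.cC1 _ _ hx (by simpa [emb] using (val_ne (Ne.symm hxy)))
  · rename_i x h1
    exact N2.cC1 _ _ (val_ne (b := .three) (by rintro rfl; exact h1 rfl)) (by simp)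
  · exact absurd h (by simp)

theorem cutE_spec {l : D} {u z : List D} (h : cutE l z = true) (hu : u.getLast? = some l) :
    Cut (emb u) (emb z) := by
  have hl : (emb u).getLast? = some (val l) := by rw [emb_getLast?, hu]; rfl
  unfold cutE at h
  split at h
  · exact (n2_spec h).cut hl
  · rename_i h1
    have h2 : 2 ∉ (emb u).getLast? := by
      rw [hl]
      have : val l ≠ val .two := val_ne h1
      rw [Option.mem_some_iff]
      exact this
    split at h
    · exact After22.cut (Or.inl rfl) h2
    · exact After22.cut (Or.inr (n2_spec h)) h2
    · exact absurd h (by simp)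

theorem piecesF_spec {E : List ℕ+ → Prop} {f : ℕ} (t : List D) : ∀ (l : D) (cur : List D),
    (∀ p ∈ piecesF t l cur, Good E f (emb p)) → Good E f (emb ((l :: cur).reverse ++ t)) := by
  induction t with
  | nil => intro l cur h; simpa using h _ (by simp [piecesF])
  | cons x t ih =>
    intro l cur h
    unfold piecesF at h
    by_cases hc : cutE l (x :: t) = true
    · rw [hc, cond_true] at h
      rw [emb_append]
      refine Good.append (h _ (by simp)) (ih x [] fun p hp => h p (by simp [hp])) ?_
      exact cutE_spec hc (by simp)
    · rw [Bool.not_eq_true] at hc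
      rw [hc, cond_false] at h
      have := ih x (l :: cur) h
      simpa using this

theorem pieces_spec {E : List ℕ+ → Prop} {f : ℕ} {w : List D}
    (h : ∀ p ∈ pieces w, Good E f (emb p)) : Good E f (emb w) := by
  cases w with
  | nil => unfold Good; rw [emb_nil, C_iter_nil]; exact Elem.nil
  | cons x t => exact piecesF_spec t x [] h

theorem memE_spec (w : List D) : ∀ {es : List (List D)}, memE w es = true → w ∈ es := by
  induction w with
  | nil =>
    intro es h
    simpa [memE] using h
  | cons c w ih =>
    intro es h
    have h1 := ih h
    obtain ⟨e, he, hs⟩ := List.mem_filterMap.1 h1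
    cases e with
    | nil => simp [strip] at hs
    | cons x t =>
      change (bif deq x c then some t else none) = some w at hs
      by_cases hx : deq x c = true
      · rw [hx, cond_true] at hs
        rw [deq_iff] at hx
        cases hs
        rwa [← hx]
      · rw [Bool.not_eq_true] at hx
        rw [hx, cond_false] at hs
        cases hs

/-- the set of common elements -/
def IsE (e : List ℕ+) : Prop := e ∈ elems.map emb

theorem isE_of {t : List D} (h : memE t elems = true) : IsE (emb t) :=
  List.mem_map_of_mem (memE_spec t h)

theorem check_closed : elems.all (fun e => good 0 (sayD e)) = true := by decide +kernel

theorem check_atoms : elems.all atomB = true := by decide +kernel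

theorem hits_spec (l : D) (f : ℕ) : ∀ {z : List D}, No4 z → hits l f z = true →
    ∃ n, val l ∈ (C^[n] (emb z)).head? := by
  induction f with
  | zero => intro z _ h; exact absurd h (by simp [hits])
  | succ f ih =>
    intro z hz h
    unfold hits at h
    rw [or_eq, Bool.or_eq_true] at h
    rcases h with h | h
    · refine ⟨0, ?_⟩
      rw [not_eq, Bool.not_eq_true', ← Bool.not_eq_true, headNe_iff, not_not] at h
      exact emb_head.2 h
    · obtain ⟨n, hn⟩ := ih (sayD_no4 hz) h
      exact ⟨n + 1, by rwa [Function.iterate_succ_apply, sayD_spec hz]⟩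

theorem atomF_spec (t : List D) : ∀ {l : D}, No4 (l :: t) → atomF t l = true →
    ∀ {u v : List D}, l :: t = u ++ v → u ≠ [] → v ≠ [] → ¬ Cut (emb u) (emb v) := by
  induction t with
  | nil =>
    intro l _ _ u v h hu hv
    rcases List.singleton_eq_append_iff.1 h with h | h
    · exact absurd h.1 hu
    · exact absurd h.2 hv
  | cons x t ih =>
    intro l h4 h u v huv hu hv
    unfold atomF at h
    rw [and_eq, Bool.and_eq_true] at h
    have h5 : No4 (x :: t) := h4.of_sub (List.suffix_cons _ _).isInfix
    cases u with
    | nil => exact absurd rfl hu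
    | cons b u =>
      simp only [List.cons_append, List.cons.injEq] at huv
      obtain ⟨rfl, huv⟩ := huv
      rcases eq_or_ne u [] with rfl | hu2
      · rw [List.nil_append] at huv
        subst huv
        intro hc
        obtain ⟨n, hn⟩ := hits_spec _ _ h5 h.1
        exact cut_iff.1 hc (val l) (by simp [emb]) n hn
      · intro hc
        refine ih h5 h.2 huv hu2 hv ?_
        have h6 : emb (l :: u) = [val l] ++ emb u := rfl
        rwa [h6, cut_append_left (by rwa [Ne, emb_eq_nil])] at hc

theorem atomB_spec {w : List D} (h : atomB w = true) : No4 w ∧ IsAtomWord (emb w) := by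
  cases w with
  | nil => exact absurd h (by simp [atomB])
  | cons x t =>
    change andB (no4 (x :: t)) (atomF t x) = true at h
    rw [and_eq, Bool.and_eq_true] at h
    have h4 := of_no4 h.1
    refine ⟨h4, by simp [emb], ?_⟩
    rintro ⟨u, v, hu, hv, huv, hc⟩
    obtain ⟨u', v', h1, rfl, rfl⟩ := List.map_eq_append_iff.1 huv
    rw [huv] at hc
    exact atomF_spec t h4 h.2 h1 (by simpa using hu) (by simpa using hv) hc

theorem isE_no4 {e : List D} (h : e ∈ elems) : No4 e :=
  (atomB_spec (List.all_eq_true.1 check_atoms e h)).1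

theorem isE_atom (e : List ℕ+) (h : IsE e) : IsAtomWord e := by
  obtain ⟨w, hw, rfl⟩ := List.mem_map.1 h
  exact (atomB_spec (List.all_eq_true.1 check_atoms w hw)).2

theorem isE_derive (e : List ℕ+) (h : IsE e) : Elem IsE (C e) := by
  obtain ⟨w, hw, rfl⟩ := List.mem_map.1 h
  have h1 : good 0 (sayD w) = true := List.all_eq_true.1 check_closed w hw
  rw [sayD_spec (isE_no4 hw)]
  have : Good IsE 0 (emb (sayD w)) := by
    apply pieces_spec
    intro p hp
    unfold good at h1
    exact Elem.single (isE_of (List.all_eq_true.1 h1 p hp))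
  exact this

theorem good_spec (f : ℕ) : ∀ {w : List D}, good f w = true → Good IsE f (emb w) := by
  induction f with
  | zero =>
    intro w h
    apply pieces_spec
    intro p hp
    unfold good at h
    exact Elem.single (isE_of (List.all_eq_true.1 h p hp))
  | succ f ih =>
    intro w h
    apply pieces_spec
    intro p hp
    unfold good at h
    have h1 := List.all_eq_true.1 h p hp
    rw [or_eq, and_eq, Bool.or_eq_true, Bool.and_eq_true] at h1
    rcases h1 with h1 | ⟨h1, h2⟩
    · exact (Elem.single (isE_of h1)).iter isE_derive (f + 1)
    · have h3 := ih h2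
      unfold Good at h3 ⊢
      rwa [Function.iterate_succ_apply, sayD_spec (of_no4 h1)]

theorem pats_of3 {y x p : D} (h1 : x ≠ p) (h2 : y ≠ x) (h3 : p ≠ .two) : [y, x, p] ∈ pats := by
  cases y <;> cases x <;> cases p <;> simp [pats] at *

theorem pats_of4 {y x q : D} (h1 : y ≠ x)
    (h2 : (q = .one ∧ x = .one) ∨ (q = .three ∧ x ≠ .three)) : [y, x, x, q] ∈ pats := by
  cases y <;> cases x <;> cases q <;> simp [pats] at *

theorem cut_spec {r m : List D} (h : cut r = some m) :
    ∃ p ∈ pats, r = p ++ m ∧ m.head? = some .two := by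
  unfold cut at h
  split at h
  · rename_i y x p q t
    rw [cond_eq_ite] at h
    split at h
    · rename_i hc
      simp only [and_eq, Bool.and_eq_true, not_deq_iff, deq_iff] at hc
      cases h
      exact ⟨_, pats_of3 hc.2.1 hc.2.2.1 hc.2.2.2, rfl, by simp [hc.1]⟩
    · split at h
      · cases h
      · rename_i s t
        rw [cond_eq_ite] at h
        split at h
        · rename_i hc
          simp only [and_eq, or_eq, Bool.and_eq_true, Bool.or_eq_true, not_deq_iff, deq_iff] at hc
          cases h
          obtain ⟨h1, h2, rfl, h3⟩ := hc
          exact ⟨_, pats_of4 h2 h3, rfl, by simp [h1]⟩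
        · cases h
  · cases h

theorem pats_ne {p : List D} (hp : p ∈ pats) : p ≠ [] := by
  rintro rfl
  simp [pats] at hp

theorem pats_n2 {p : List D} (hp : p ∈ pats) (s : List D) : N2 (emb (p.reverse ++ s)) := by
  have cA : ∀ x y : D, x ≠ .one → y ≠ x → N2 (emb (.one :: x :: y :: s)) := fun x y h1 h2 =>
    N2.cA _ _ (val_ne h1) (by simpa [emb] using val_ne h2)
  have cB : ∀ y : D, y ≠ .one → N2 (emb (.one :: .one :: .one :: y :: s)) := fun y h2 =>
    N2.cB _ (by rw [show (1 : ℕ+) = val .one from rfl]; simpa [emb] using val_ne h2)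
  have cC1 : ∀ x y : D, x ≠ .three → y ≠ x → N2 (emb (.three :: x :: y :: s)) := fun x y h1 h2 =>
    N2.cC1 _ _ (val_ne h1) (by simpa [emb] using val_ne h2)
  have cC2 : ∀ x y : D, x ≠ .three → y ≠ x → N2 (emb (.three :: x :: x :: y :: s)) :=
    fun x y h1 h2 => N2.cC2 _ _ (val_ne h1) (by simpa [emb] using val_ne h2)
  simp only [pats, List.mem_cons, List.not_mem_nil, or_false] at hp
  rcases hp with rfl | rfl | rfl | rfl | rfl | rfl | rfl | rfl | rfl | rfl | rfl | rfl | rfl | rfl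
  all_goals first
    | exact cA _ _ (by simp) (by simp)
    | exact cB _ (by simp)
    | exact cC1 _ _ (by simp) (by simp)
    | exact cC2 _ _ (by simp) (by simp)

end Elements

/-! ### The search -/

section Search

local notation "C" => lookAndSay

/-- one step of `dfs` -/
noncomputable def stepD (left : Bool) (b : ℕ) (good : List D → Bool) (f : ℕ) (r rl : List D)
    (c : D) : Bool :=
  orB (notB (legal left b (c :: rl)))
    (match cut (c :: r) with
    | some m => good m
    | none => dfs left b good f (c :: r) (c :: rl))

theorem dfs_succ (left : Bool) (b : ℕ) (good : List D → Bool) (f : ℕ) (r rl : List D) :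
    dfs left b good (f + 1) r rl = true ↔ ∀ c, stepD left b good f r rl c = true := by
  have : dfs left b good (f + 1) r rl = andB (stepD left b good f r rl .one)
    (andB (stepD left b good f r rl .two) (stepD left b good f r rl .three)) := rfl
  rw [this, and_eq, and_eq, Bool.and_eq_true, Bool.and_eq_true]
  constructor
  · rintro ⟨h1, h2, h3⟩ c
    cases c <;> assumption
  · intro h; exact ⟨h _, h _, h _⟩

theorem dfs_spec (left : Bool) (b : ℕ) (good : List D → Bool) (f : ℕ) :
    ∀ {r l v u : List D}, dfs left b good f r (r ++ l) = true → Lev b (v ++ ((r ++ l) ++ u)) →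
      (left = true → u = []) → f ≤ v.length →
      ∃ v2 p m, v ++ r = v2 ++ (p ++ m) ∧ p ∈ pats ∧ m.head? = some .two ∧ good m = true := by
  induction f with
  | zero => intro r l v u h; exact absurd h (by simp [dfs])
  | succ f ih =>
    intro r l v u h hL hl hf
    rcases List.eq_nil_or_concat v with rfl | ⟨v, c, rfl⟩
    · simp at hf
    · rw [List.concat_eq_append] at *
      have h1 := (dfs_succ left b good f r (r ++ l)).1 h c
      unfold stepD at h1
      have hL' : Lev b (v ++ ((c :: (r ++ l)) ++ u)) := by simpa using hL
      have h2 := legal_of left b hL' hl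
      rw [h2, or_eq, not_eq, Bool.not_true, Bool.false_or] at h1
      cases hc : cut (c :: r) with
      | some m =>
        rw [hc] at h1
        obtain ⟨p, hp, he, hm⟩ := cut_spec hc
        exact ⟨v, p, m, by rw [List.append_assoc, ← he]; rfl, hp, hm, h1⟩
      | none =>
        rw [hc] at h1
        obtain ⟨v2, p, m, h3, h4⟩ := ih (r := c :: r) (l := l) (v := v) (u := u) h1 hL' hl
          (by simpa using hf)
        exact ⟨v2, p, m, by rw [← h3]; simp, h4⟩

/-- the predicate checked at the leaves of the search -/
noncomputable def leaf (m : List D) : Bool := good 12 m.reverse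

/-- the search started after a cut, the next letters being `p` -/
def CheckR (p : List D) : Prop := dfs false 12 leaf 60 p (p ++ [.two]) = true

theorem left_one : stepD true 12 leaf 59 [] [] .one = true := by decide +kernel
theorem left_two : stepD true 12 leaf 59 [] [] .two = true := by decide +kernel
theorem left_three : stepD true 12 leaf 59 [] [] .three = true := by decide +kernel
theorem right_121 : CheckR [.one, .two, .one] := by
  unfold CheckR; decide +kernel
theorem right_321 : CheckR [.three, .two, .one] := by
  unfold CheckR; decide +kernel
theorem right_131 : CheckR [.one, .three, .one] := by
  unfold CheckR; decide +kernel
theorem right_231 : CheckR [.two, .three, .one] := by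
  unfold CheckR; decide +kernel
theorem right_2111 : CheckR [.two, .one, .one, .one] := by
  unfold CheckR; decide +kernel
theorem right_3111 : CheckR [.three, .one, .one, .one] := by
  unfold CheckR; decide +kernel
theorem right_213 : CheckR [.two, .one, .three] := by
  unfold CheckR; decide +kernel
theorem right_313 : CheckR [.three, .one, .three] := by
  unfold CheckR; decide +kernel
theorem right_123 : CheckR [.one, .two, .three] := by
  unfold CheckR; decide +kernel
theorem right_323 : CheckR [.three, .two, .three] := by
  unfold CheckR; decide +kernel
theorem right_2113 : CheckR [.two, .one, .one, .three] := by
  unfold CheckR; decide +kernel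
theorem right_3113 : CheckR [.three, .one, .one, .three] := by
  unfold CheckR; decide +kernel
theorem right_1223 : CheckR [.one, .two, .two, .three] := by
  unfold CheckR; decide +kernel
theorem right_3223 : CheckR [.three, .two, .two, .three] := by
  unfold CheckR; decide +kernel

theorem check_left : dfs true 12 leaf 60 [] [] = true := by
  rw [dfs_succ]
  intro c
  cases c
  · exact left_one
  · exact left_two
  · exact left_three

theorem check_right {p : List D} (hp : p ∈ pats) : dfs false 12 leaf 60 p (p ++ [.two]) = true := by
  change CheckR p
  simp only [pats, List.mem_cons, List.not_mem_nil, or_false] at hp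
  rcases hp with rfl | rfl | rfl | rfl | rfl | rfl | rfl | rfl | rfl | rfl | rfl | rfl | rfl | rfl
  · exact right_121
  · exact right_321
  · exact right_131
  · exact right_231
  · exact right_2111
  · exact right_3111
  · exact right_213
  · exact right_313
  · exact right_123
  · exact right_323
  · exact right_2113
  · exact right_3113
  · exact right_1223
  · exact right_3223


theorem pats_length {p : List D} (hp : p ∈ pats) : p.length ≤ 4 := by
  simp only [pats, List.mem_cons, List.not_mem_nil, or_false] at hp
  rcases hp with rfl | rfl | rfl | rfl | rfl | rfl | rfl | rfl | rfl | rfl | rfl | rfl | rfl | rfl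
  all_goals simp

theorem pats_cut {p v m : List D} (hp : p ∈ pats) (hm : m.head? = some .two) :
    Cut (emb m.reverse) (emb (v ++ p).reverse) := by
  rw [List.reverse_append]
  refine (pats_n2 hp _).cut ?_
  rw [emb_getLast?, List.getLast?_reverse, hm]
  rfl

theorem good_suffix {t a : List D} (hL : Lev 12 (t ++ a)) (hT : Good IsE 12 (emb t.reverse))
    (ht : 64 ≤ t.length) (n : ℕ) : ∀ {v p u : List D}, (v ++ p).length = n → p ∈ pats →
      t ++ a = (v ++ p) ++ .two :: u → Good IsE 12 (emb (v ++ p).reverse) := by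
  induction n using Nat.strong_induction_on with
  | _ n ih =>
    intro v p u hn hp hS
    have hp4 := pats_length hp
    rw [List.length_append] at hn
    by_cases hv : 60 ≤ v.length
    · obtain ⟨v2, p2, m, h1, h2, h3, h4⟩ := dfs_spec false 12 leaf 60 (r := p) (l := [.two])
        (v := v) (u := u) (check_right hp) (by rw [hS] at hL; simpa using hL) (by simp) hv
      cases m with
      | nil => simp at h3
      | cons d m =>
        have hd : d = .two := by simpa using h3
        subst hd
        have h5 := ih (v2 ++ p2).length (by
          have := congrArg List.length h1
          simp only [List.length_append, List.length_cons] at this ⊢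
          omega) (v := v2) (p := p2) (u := m ++ .two :: u) rfl h2 (by rw [hS, h1]; simp)
        rw [h1, ← List.append_assoc, List.reverse_append, emb_append]
        exact (good_spec 12 h4).append h5 (pats_cut h2 h3)
    · obtain ⟨t', ht'⟩ : ∃ t', t = (v ++ p) ++ t' := by
        have h1 : (v ++ p) <+: t ++ a := ⟨_, hS.symm⟩
        obtain ⟨t', h2⟩ := List.prefix_of_prefix_length_le h1 (List.prefix_append t a)
          (by rw [List.length_append]; omega)
        exact ⟨t', h2.symm⟩
      subst ht'
      cases t' with
      | nil =>
        simp only [List.length_append, List.append_nil] at ht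
        omega
      | cons d t' =>
        have hd : d = .two := by
          rw [List.append_assoc] at hS
          have := List.append_cancel_left hS
          simp only [List.cons_append, List.cons.injEq] at this
          exact this.1
        subst hd
        rw [List.reverse_append, emb_append] at hT
        exact (hT.of_cut isE_atom (pats_cut hp rfl)).2

theorem good_all {t a : List D} (hL : Lev 12 (t ++ a)) (hT : Good IsE 12 (emb t.reverse))
    (ht : 64 ≤ t.length) : Good IsE 12 (emb (t ++ a).reverse) := by
  obtain ⟨v2, p, m, h1, h2, h3, h4⟩ := dfs_spec true 12 leaf 60 (r := []) (l := [])
    (v := t ++ a) (u := []) check_left (by simpa using hL) (by simp) (by simp; omega)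
  rw [List.append_nil, ← List.append_assoc] at h1
  cases m with
  | nil => simp at h3
  | cons d m =>
    have hd : d = .two := by simpa using h3
    subst hd
    have h5 := good_suffix hL hT ht _ rfl h2 h1
    rw [h1, List.reverse_append, emb_append]
    exact (good_spec 12 h4).append h5 (pats_cut h2 h3)

/-! ### Padding -/

theorem No4.append {x y : List D} (hx : No4 x) (hy : No4 y)
    (h : ∀ a ∈ x.getLast?, a ∉ y.head?) : No4 (x ++ y) := by
  induction x with
  | nil => simpa using hy
  | cons b x ih =>
    intro a ha
    rcases List.infix_cons_iff.1 ha with h2 | h2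
    · have h2 : [a, a, a, a] <+: b :: (x ++ y) := h2
      match x, hx, h, h2 with
      | [], _, h, h2 =>
        simp only [List.nil_append, List.cons_prefix_cons] at h2
        obtain ⟨rfl, s, rfl⟩ := h2
        exact h a (by simp) (by simp)
      | [c], _, h, h2 =>
        simp only [List.cons_append, List.nil_append, List.cons_prefix_cons] at h2
        obtain ⟨rfl, rfl, s, rfl⟩ := h2
        exact h a (by simp) (by simp)
      | [c, d], _, h, h2 =>
        simp only [List.cons_append, List.nil_append, List.cons_prefix_cons] at h2
        obtain ⟨rfl, rfl, rfl, s, rfl⟩ := h2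
        exact h a (by simp) (by simp)
      | c :: d :: e :: x, hx, _, h2 =>
        simp only [List.cons_append, List.cons_prefix_cons] at h2
        obtain ⟨rfl, rfl, rfl, rfl, -⟩ := h2
        exact hx a (List.prefix_append [a, a, a, a] x).isInfix
    · refine ih (hx.of_sub (List.suffix_cons _ _).isInfix) ?_ a h2
      intro c hc
      refine h c ?_
      cases x with
      | nil => simp at hc
      | cons d x => simpa using hc

/-- the padding word `322322...322` -/
def pad : List D := (List.replicate 10 [.three, .two, .two]).flatten

theorem sayD_iter {w : List D} (h : No4 w) (n : ℕ) : C^[n] (emb w) = emb (sayD^[n] w) := by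
  induction n generalizing w with
  | zero => rfl
  | succ n ih => rw [Function.iterate_succ_apply, sayD_spec h, ih (sayD_no4 h),
      Function.iterate_succ_apply]

theorem pad_good : good 0 pad = true := by decide +kernel
theorem pad2_good : good 0 (.two :: .two :: pad) = true := by decide +kernel
theorem pad_no4 : no4 pad = true := by decide +kernel
theorem pad2_no4 : no4 (.two :: .two :: pad) = true := by decide +kernel
theorem pad_length : 64 ≤ (sayD^[12] pad).length := by decide +kernel
theorem pad2_length : 64 ≤ (sayD^[12] (.two :: .two :: pad)).length := by decide +kernel

theorem exists_pad {x : List D} (hx : x ≠ []) : ∃ q : List D, Cut (emb x) (emb q) ∧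
    good 0 q = true ∧ No4 q ∧ 64 ≤ (sayD^[12] q).length ∧ ∀ a ∈ x.getLast?, a ∉ q.head? := by
  obtain ⟨l, hl⟩ : ∃ l, x.getLast? = some l := by
    rw [← Option.isSome_iff_exists, List.getLast?_isSome]; exact hx
  by_cases h2 : l = .two
  · subst h2
    refine ⟨pad, cutE_spec (l := .two) (by decide +kernel) hl, pad_good, of_no4 pad_no4,
      pad_length, ?_⟩
    rw [hl]
    intro a ha
    have : D.two = a := by simpa using ha
    subst this
    simp [pad, List.replicate_succ]
  · refine ⟨.two :: .two :: pad, cutE_spec (l := l) ?_ hl, pad2_good, of_no4 pad2_no4,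
      pad2_length, ?_⟩
    · cases l with
      | two => exact absurd rfl h2
      | one => decide +kernel
      | three => decide +kernel
    · rw [hl]
      intro a ha
      have : l = a := by simpa using ha
      subst this
      simpa using Ne.symm h2

theorem elem24 {x : List D} (hx : x ≠ []) (h4 : No4 x) : Elem IsE (C^[24] (emb x)) := by
  obtain ⟨q, hc, hg, hq, hlen, hne⟩ := exists_pad hx
  have hxq : No4 (x ++ q) := h4.append hq hne
  obtain ⟨s, h1, -, h3⟩ := Lev.exists hxq.reverse 12
  rw [List.reverse_reverse, emb_append, hc 12] at h3
  obtain ⟨A, T, h5, h6, h7⟩ := List.map_eq_append_iff.1 h3.symm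
  have hs : s = T.reverse ++ A.reverse := by
    rw [← List.reverse_append, ← h5, List.reverse_reverse]
  have hT : Good IsE 12 (emb T) := by
    change emb T = _ at h7
    rw [h7]
    exact ((good_spec 0 hg).iter isE_derive 12).iter isE_derive 12
  have hlT : 64 ≤ T.length := by
    have h8 := sayD_iter hq 12
    rw [← h7] at h8
    rw [emb_inj h8]; exact hlen
  subst hs
  have h9 := good_all h1 (by simpa using hT) (by simpa using hlT)
  rw [← List.reverse_append, List.reverse_reverse, emb_append] at h9
  change emb A = _ at h6
  change emb T = _ at h7
  have hcut : Cut (emb A) (emb T) := by rw [h6, h7]; exact hc.iter 12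
  have h10 := (h9.of_cut isE_atom hcut).1
  unfold Good at h10
  rw [h6, ← Function.iterate_add_apply] at h10
  exact h10

theorem exists_emb (x : List ℕ+) (h : ∀ a ∈ x, a ≤ 3) : ∃ w, emb w = x := by
  induction x with
  | nil => exact ⟨[], rfl⟩
  | cons a x ih =>
    obtain ⟨w, rfl⟩ := ih fun b hb => h b (by simp [hb])
    have ha : (a : ℕ) ≤ 3 := by exact_mod_cast h a (by simp)
    have ha0 := a.pos
    obtain ⟨d, rfl⟩ : ∃ d, val d = a := by
      have : (a : ℕ) = 1 ∨ (a : ℕ) = 2 ∨ (a : ℕ) = 3 := by omega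
      rcases this with h | h | h
      · exact ⟨.one, PNat.eq h.symm⟩
      · exact ⟨.two, PNat.eq h.symm⟩
      · exact ⟨.three, PNat.eq h.symm⟩
    exact ⟨d :: w, rfl⟩

theorem val_le (d : D) : val d ≤ 3 := by cases d <;> decide

theorem elems_length : elems.length = 92 := by
  rw [elems, List.length_map]
  rfl

theorem isE_factor {x : List ℕ+} (hx : x ≠ []) (h3 : ∀ a ∈ x, a ≤ 3) (hd : DayOne x) {n : ℕ}
    (hn : 24 ≤ n) {u : List ℕ+} (hu : AtomicFactor u (C^[n] x)) : IsE u := by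
  obtain ⟨w, rfl⟩ := exists_emb x h3
  have h4 : No4 w := by
    intro a ha
    exact hd (val a) (ha.map val)
  have hw : w ≠ [] := by rintro rfl; exact hx rfl
  have h5 : Elem IsE (C^[n] (emb w)) := by
    have := (elem24 hw h4).iter isE_derive (n - 24)
    rwa [← Function.iterate_add_apply, Nat.sub_add_cancel hn] at this
  obtain ⟨us, h6, h7, h8⟩ := hu
  exact h5.atomicFactor isE_atom h6 h7 u h8

end Search

end LS

theorem cosmological_theorem :
    ∃ E : Finset (List ℕ+), E.card ≤ 92 ∧
      (∀ u ∈ E, IsAtomWord u ∧ ∀ a ∈ u, a ≤ 3) ∧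
      ∀ x : List ℕ+, x ≠ [] → (∀ a ∈ x, a ≤ 3) → DayOne x →
        ∀ n : ℕ, 24 ≤ n → ∀ u : List ℕ+, AtomicFactor u (lookAndSay^[n] x) → u ∈ E := by
  refine ⟨(LS.elems.map LS.emb).toFinset, ?_, ?_, ?_⟩
  · refine (List.toFinset_card_le _).trans ?_
    rw [List.length_map, LS.elems_length]
  · intro u hu
    have hu2 : LS.IsE u := List.mem_toFinset.1 hu
    refine ⟨LS.isE_atom u hu2, ?_⟩
    obtain ⟨w, -, rfl⟩ := List.mem_map.1 hu2
    intro a ha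
    obtain ⟨d, -, rfl⟩ := List.mem_map.1 ha
    exact LS.val_le d
  · intro x hx h3 hd n hn u hu
    exact List.mem_toFinset.2 (LS.isE_factor hx h3 hd hn hu)
end
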